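/- Finite analogue of the characterisation of duality: fix a positive integer m, and suppose {𝔻_n}_{0≤n≤m} is a collection of ℂ-linear endomorphisms 𝔻_n : C_n → C_n such that (i') 𝔻_0 = id on C_0 = ℂ and 𝔻_{n₁+n₂}(R^{n₁+n₂}_{n₁,n₂}(f₁ ⊠ f₂)) = R^{n₁+n₂}_{n₁,n₂}(𝔻_{n₁}(f₁) ⊠ 𝔻_{n₂}(f₂)) for all n₁, n₂ ≥ 1 with n₁ + n₂ ≤ m and all f_i ∈ C_{n_i}, and (ii') 𝔻_n(f) = (-1)^{n-1} f for every pre-cuspidal f ∈ C_n and every 1 ≤ n ≤ m. Then 𝔻_n = 𝒟_n for every 0 ≤ n ≤ m. -/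

import Mathlib

open Matrix BigOperators

namespace HCPaper

open scoped Classical

/-- `gl F n` : the additive group of `n × n` matrices over `F`. -/
abbrev gl (F : Type) (n : ℕ) := Matrix (Fin n) (Fin n) F

variable {F : Type} [Field F] [Fintype F] [DecidableEq F]

/-- Conjugation (adjoint) action of `GL_n(F)` on `gl_n(F)`. -/
def conjM {n : ℕ} (g : Matrix.GeneralLinearGroup (Fin n) F) (x : gl F n) : gl F n :=
  (g : Matrix (Fin n) (Fin n) F) * x * ((g⁻¹ : Matrix.GeneralLinearGroup (Fin n) F) : Matrix (Fin n) (Fin n) F)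

/-- A function `f : gl_n(F) → ℂ` is invariant if it is constant on `GL_n(F)`-conjugacy orbits. -/
def Invariant (n : ℕ) (f : gl F n → ℂ) : Prop :=
  ∀ (g : Matrix.GeneralLinearGroup (Fin n) F) (x : gl F n), f (conjM g x) = f x

/-- Invariance for functions on `gl_k(F) × gl_l(F)` under `GL_k(F) × GL_l(F)`. -/
def Invariant₂ (k l : ℕ) (h : gl F k × gl F l → ℂ) : Prop :=
  ∀ (g₁ : Matrix.GeneralLinearGroup (Fin k) F) (g₂ : Matrix.GeneralLinearGroup (Fin l) F)
    (x : gl F k) (y : gl F l), h (conjM g₁ x, conjM g₂ y) = h (x, y)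

/-- Transport of matrices along an equality of sizes. -/
def castM {m n : ℕ} (h : m = n) (x : gl F m) : gl F n :=
  Matrix.reindex (finCongr h) (finCongr h) x

/-- Transport of functions along an equality of sizes. -/
def castFun {m n : ℕ} (h : m = n) (f : gl F m → ℂ) : gl F n → ℂ :=
  fun x => f (castM h.symm x)

/-- The block upper-triangular matrix `[x u; 0 y]`, viewed in `gl_{k+l}(F)`. -/
def but (k l : ℕ) (x : gl F k) (u : Matrix (Fin k) (Fin l) F) (y : gl F l) : gl F (k + l) :=
  Matrix.reindex finSumFinEquiv finSumFinEquiv (Matrix.fromBlocks x u 0 y)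

/-- The block lower-triangular matrix `[x 0; v y]`, viewed in `gl_{k+l}(F)`. -/
def blt (k l : ℕ) (x : gl F k) (v : Matrix (Fin l) (Fin k) F) (y : gl F l) : gl F (k + l) :=
  Matrix.reindex finSumFinEquiv finSumFinEquiv (Matrix.fromBlocks x 0 v y)

/-- View a matrix in `gl_{k+l}(F)` as a `2 × 2`-block matrix. -/
def blk (k l : ℕ) (m : gl F (k + l)) : Matrix (Fin k ⊕ Fin l) (Fin k ⊕ Fin l) F :=
  Matrix.reindex finSumFinEquiv.symm finSumFinEquiv.symm m

/-- Membership in `P_{k,l}` : being block upper triangular with blocks of sizes `k, l`. -/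
def IsBUT (k l : ℕ) (m : gl F (k + l)) : Prop := Matrix.toBlocks₂₁ (blk k l m) = 0

/-- The projection `π : P_{k,l} → gl_k(F) × gl_l(F)` deleting the off-diagonal block. -/
def proj (k l : ℕ) (m : gl F (k + l)) : gl F k × gl F l :=
  (Matrix.toBlocks₁₁ (blk k l m), Matrix.toBlocks₂₂ (blk k l m))

/-- The order of the group `P^×_{k,l}` of invertible block upper-triangular matrices. -/
noncomputable def Pcard (F : Type) [Field F] [Fintype F] [DecidableEq F] (k l : ℕ) : ℕ :=
  Nat.card {g : Matrix.GeneralLinearGroup (Fin (k + l)) F //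
    IsBUT k l (g : Matrix (Fin (k + l)) (Fin (k + l)) F)}

/-- Harish-Chandra restriction `*R^{k+l}_{k,l}`; by convention it is the identity
(under the canonical identifications) when `k = 0` or `l = 0`. -/
noncomputable def HCres (k l : ℕ) (f : gl F (k + l) → ℂ) : gl F k × gl F l → ℂ :=
  if hk : k = 0 then fun p => f (castM (by omega) p.2)
  else if hl : l = 0 then fun p => f (castM (by omega) p.1)
  else fun p =>
    ((Fintype.card F : ℂ) ^ (k * l))⁻¹ * ∑ u : Matrix (Fin k) (Fin l) F, f (but k l p.1 u p.2)

/-- Harish-Chandra induction `R^{k+l}_{k,l}`; by convention it is the identity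
(under the canonical identifications) when `k = 0` or `l = 0`. -/
noncomputable def HCind (k l : ℕ) (h : gl F k × gl F l → ℂ) : gl F (k + l) → ℂ :=
  if hk : k = 0 then fun z => h (0, castM (by omega) z)
  else if hl : l = 0 then fun z => h (castM (by omega) z, 0)
  else fun z =>
    ((Pcard F k l : ℂ))⁻¹ *
      ∑ g : Matrix.GeneralLinearGroup (Fin (k + l)) F,
        if IsBUT k l (conjM g z) then h (proj k l (conjM g z)) else 0

/-- The hermitian inner product on `C_n`. -/
noncomputable def inn (n : ℕ) (f g : gl F n → ℂ) : ℂ :=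
  ((Fintype.card (Matrix.GeneralLinearGroup (Fin n) F) : ℂ))⁻¹ *
    ∑ x : gl F n, f x * (starRingEnd ℂ) (g x)

/-- The hermitian inner product on invariant functions on `gl_k(F) × gl_l(F)`. -/
noncomputable def inn₂ (k l : ℕ) (f g : gl F k × gl F l → ℂ) : ℂ :=
  ((Fintype.card (Matrix.GeneralLinearGroup (Fin k) F) *
      Fintype.card (Matrix.GeneralLinearGroup (Fin l) F) : ℂ))⁻¹ *
    ∑ p : gl F k × gl F l, f p * (starRingEnd ℂ) (g p)

/-- `f ∈ C_n` is pre-cuspidal if all proper Harish-Chandra restrictions of `f` vanish. -/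
def PreCuspidal (n : ℕ) (f : gl F n → ℂ) : Prop :=
  ∀ (k l : ℕ), 1 ≤ k → 1 ≤ l → ∀ hkl : k + l = n, HCres k l (castFun hkl.symm f) = 0

/-- The composite `R_{(n_1,…,n_r)} ∘ *R_{(n_1,…,n_r)}` of the iterated two-block
Harish-Chandra induction and restriction along the composition `(n_1,…,n_r)`. -/
noncomputable def RcompRes : (L : List ℕ) → (gl F L.sum → ℂ) → gl F L.sum → ℂ
  | [], f => f
  | (k :: L), f =>
      castFun (List.sum_cons).symm
        (HCind k L.sum fun p =>
          RcompRes L (fun y => HCres k L.sum (castFun List.sum_cons f) (p.1, y)) p.2)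

/-- The duality operation `𝒟_n(f) = Σ_{(n_1,…,n_r) ⊨ n} (-1)^{n-r}
R_{(n_1,…,n_r)}(*R_{(n_1,…,n_r)} f)`, the sum over all compositions of `n`. -/
noncomputable def Dual (n : ℕ) (f : gl F n → ℂ) : gl F n → ℂ :=
  ∑ c : Composition n,
    ((-1 : ℂ)) ^ (n - c.length) •
      castFun c.blocks_sum (RcompRes c.blocks (castFun c.blocks_sum.symm f))

/-- `C_n`, the subspace of invariant functions, as a `ℂ`-submodule of all functions. -/
noncomputable def InvSub (F : Type) [Field F] (n : ℕ) : Submodule ℂ (gl F n → ℂ) where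
  carrier := {f | Invariant n f}
  add_mem' := by
    intro a b ha hb g x
    simp only [Pi.add_apply]
    rw [ha g x, hb g x]
  zero_mem' := by intro g x; rfl
  smul_mem' := by
    intro c f hf g x
    simp only [Pi.smul_apply]
    rw [hf g x]

/-- `χ` is the character of a finite-dimensional complex representation of the
additive group `gl_n(F)`. -/
def IsChar (n : ℕ) (χ : gl F n → ℂ) : Prop :=
  ∃ V : FDRep ℂ (Multiplicative (gl F n)),
    ∀ x : gl F n, FDRep.character V (Multiplicative.ofAdd x) = χ x

/-- An invariant character of `gl_n(F)`. -/
def IsInvChar (n : ℕ) (χ : gl F n → ℂ) : Prop := IsChar n χ ∧ Invariant n χ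

/-- A character of the additive group `gl_k(F) × gl_l(F)`. -/
def IsChar₂ (k l : ℕ) (χ : gl F k × gl F l → ℂ) : Prop :=
  ∃ V : FDRep ℂ (Multiplicative (gl F k × gl F l)),
    ∀ p : gl F k × gl F l, FDRep.character V (Multiplicative.ofAdd p) = χ p

/-- An invariant character of `gl_k(F) × gl_l(F)`. -/
def IsInvChar₂ (k l : ℕ) (χ : gl F k × gl F l → ℂ) : Prop := IsChar₂ k l χ ∧ Invariant₂ k l χ

/-- An irreducible invariant character: a nonzero invariant character which is not
the sum of two nonzero invariant characters. -/
def IrrInvChar (n : ℕ) (χ : gl F n → ℂ) : Prop :=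
  IsInvChar n χ ∧ χ ≠ 0 ∧
    ¬ ∃ χ₁ χ₂ : gl F n → ℂ, IsInvChar n χ₁ ∧ IsInvChar n χ₂ ∧ χ₁ ≠ 0 ∧ χ₂ ≠ 0 ∧ χ = χ₁ + χ₂


set_option linter.unusedSectionVars false

/-- Invertible (formally rectangular) matrices. -/
structure MIso (F : Type) [Field F] (α β : Type) [Fintype α] [DecidableEq α]
    [Fintype β] [DecidableEq β] where
  m : Matrix α β F
  i : Matrix β α F
  mi : m * i = 1
  im : i * m = 1

section MIsoBasics

variable {α β γ δ ι κ : Type} [Fintype α] [DecidableEq α] [Fintype β] [DecidableEq β]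
  [Fintype γ] [DecidableEq γ] [Fintype δ] [DecidableEq δ] [Fintype ι] [DecidableEq ι]
  [Fintype κ] [DecidableEq κ]

namespace MIso

theorem ext_m {G H : MIso F α β} (h : G.m = H.m) : G = H := by
  have hi : G.i = H.i := by
    calc G.i = G.i * (H.m * H.i) := by rw [H.mi, Matrix.mul_one]
      _ = (G.i * G.m) * H.i := by rw [h, Matrix.mul_assoc]
      _ = H.i := by rw [G.im, Matrix.one_mul]
  cases G; cases H; simp_all

noncomputable instance : Fintype (MIso F α β) :=
  Fintype.ofInjective (fun G => G.m) (fun _ _ h => ext_m h)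

/-- Identity. -/
def one (F : Type) [Field F] (α : Type) [Fintype α] [DecidableEq α] : MIso F α α :=
  ⟨1, 1, Matrix.one_mul _, Matrix.one_mul _⟩

/-- Inverse. -/
def symm (G : MIso F α β) : MIso F β α := ⟨G.i, G.m, G.im, G.mi⟩

/-- Composition. -/
def comp (G : MIso F α β) (H : MIso F β γ) : MIso F α γ where
  m := G.m * H.m
  i := H.i * G.i
  mi := by
    calc G.m * H.m * (H.i * G.i) = G.m * (H.m * H.i) * G.i := by simp only [Matrix.mul_assoc]
      _ = 1 := by rw [H.mi, Matrix.mul_one, G.mi]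
  im := by
    calc H.i * G.i * (G.m * H.m) = H.i * (G.i * G.m) * H.m := by simp only [Matrix.mul_assoc]
      _ = 1 := by rw [G.im, Matrix.mul_one, H.im]

/-- Conjugation. -/
def conj (G : MIso F α β) (z : Matrix β β F) : Matrix α α F := G.m * z * G.i

theorem comp_assoc (G : MIso F α β) (H : MIso F β γ) (K : MIso F γ δ) :
    (G.comp H).comp K = G.comp (H.comp K) := ext_m (Matrix.mul_assoc _ _ _)

theorem symm_comp (G : MIso F α β) : G.symm.comp G = one F β := ext_m G.im
theorem comp_symm (G : MIso F α β) : G.comp G.symm = one F α := ext_m G.mi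
theorem one_comp (G : MIso F α β) : (one F α).comp G = G := ext_m (Matrix.one_mul _)
theorem comp_one (G : MIso F α β) : G.comp (one F β) = G := ext_m (Matrix.mul_one _)
theorem symm_symm (G : MIso F α β) : G.symm.symm = G := rfl
theorem symm_comp_cancel (G : MIso F α β) (H : MIso F β γ) : G.symm.comp (G.comp H) = H := by
  rw [← comp_assoc, symm_comp, one_comp]
theorem comp_symm_cancel (G : MIso F α β) (H : MIso F α γ) : G.comp (G.symm.comp H) = H := by
  rw [← comp_assoc, comp_symm, one_comp]
theorem comp_conj (G : MIso F α β) (H : MIso F β γ) (z : Matrix γ γ F) :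
    (G.comp H).conj z = G.conj (H.conj z) := by
  simp only [conj, comp, Matrix.mul_assoc]
theorem one_conj (z : Matrix α α F) : (one F α).conj z = z := by
  simp [conj, one]
theorem symm_conj (G : MIso F α β) (z : Matrix β β F) : G.symm.conj (G.conj z) = z := by
  rw [← comp_conj, symm_comp, one_conj]
theorem conj_symm (G : MIso F α β) (z : Matrix α α F) : G.conj (G.symm.conj z) = z := by
  rw [← comp_conj, comp_symm, one_conj]

/-- Conjugation as an equivalence. -/
def conjE (G : MIso F α β) : Matrix β β F ≃ Matrix α α F :=
  ⟨G.conj, G.symm.conj, G.symm_conj, G.conj_symm⟩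

/-- Left composition as an equivalence. -/
def compL (G : MIso F α β) : MIso F β γ ≃ MIso F α γ :=
  ⟨G.comp, G.symm.comp, fun H => symm_comp_cancel G H, fun H => comp_symm_cancel G H⟩

/-- Inversion as an equivalence. -/
def symmE : MIso F α β ≃ MIso F β α := ⟨symm, symm, fun _ => rfl, fun _ => rfl⟩

/-- Right composition as an equivalence. -/
def compR (H : MIso F β γ) : MIso F α β ≃ MIso F α γ :=
  ⟨fun G => G.comp H, fun G => G.comp H.symm,
    fun G => by simp only [comp_assoc, comp_symm, comp_one],
    fun G => by simp only [comp_assoc, symm_comp, comp_one]⟩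

theorem card_eq (G : MIso F α β) : Fintype.card α = Fintype.card β :=
  Matrix.square_of_invertible G.m G.i G.mi G.im

/-- Permutation-type isomorphisms. -/
def ofEquiv (F : Type) [Field F] (e : α ≃ β) : MIso F α β where
  m := (1 : Matrix β β F).submatrix e id
  i := (1 : Matrix β β F).submatrix id e
  mi := by
    ext a b
    simp [Matrix.mul_apply, Matrix.one_apply]
  im := by
    rw [Matrix.submatrix_mul_equiv]; simp

theorem ofEquiv_conj (e : α ≃ β) (z : Matrix β β F) : (ofEquiv F e).conj z = z.submatrix e e := by
  ext a b
  simp [conj, ofEquiv, Matrix.mul_apply, Matrix.one_apply]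

theorem exists_of_card (h : Fintype.card α = Fintype.card β) : Nonempty (MIso F α β) :=
  ⟨ofEquiv F (Fintype.equivOfCardEq h)⟩

/-- Block upper triangular isomorphisms. -/
def but (g : MIso F α γ) (h : MIso F β δ) (v : Matrix α δ F) : MIso F (α ⊕ β) (γ ⊕ δ) where
  m := fromBlocks g.m v 0 h.m
  i := fromBlocks g.i (-(g.i * v * h.i)) 0 h.i
  mi := by
    have : g.m * (g.i * v * h.i) = v * h.i := by
      rw [← Matrix.mul_assoc, ← Matrix.mul_assoc, g.mi, Matrix.one_mul]
    simp [fromBlocks_multiply, g.mi, h.mi, this]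
  im := by
    have : g.i * v * h.i * h.m = g.i * v := by
      rw [Matrix.mul_assoc, h.im, Matrix.mul_one]
    simp [fromBlocks_multiply, g.im, h.im, this]

theorem but_conj (g : MIso F α γ) (h : MIso F β δ) (v : Matrix α δ F)
    (x : Matrix γ γ F) (u : Matrix γ δ F) (y : Matrix δ δ F) :
    (but g h v).conj (fromBlocks x u 0 y) =
      fromBlocks (g.conj x) (g.m * u * h.i + (v * y * h.i - g.m * x * (g.i * v * h.i))) 0
        (h.conj y) := by
  simp only [conj, but, fromBlocks_multiply]
  congr 1
  · simp
  · simp [Matrix.add_mul]; abel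
  · simp
  · simp

theorem but_conj_21 (g : MIso F α γ) (h : MIso F β δ) (v : Matrix α δ F)
    (z : Matrix (γ ⊕ δ) (γ ⊕ δ) F) :
    ((but g h v).conj z).toBlocks₂₁ = 0 ↔ z.toBlocks₂₁ = 0 := by
  have key : ((but g h v).conj z).toBlocks₂₁ = h.m * z.toBlocks₂₁ * g.i := by
    conv_lhs => rw [← fromBlocks_toBlocks z]
    simp [conj, but, fromBlocks_multiply]
  rw [key]
  constructor
  · intro hz
    calc z.toBlocks₂₁ = (h.i * h.m) * z.toBlocks₂₁ * (g.i * g.m) := by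
          rw [h.im, g.im, Matrix.one_mul, Matrix.mul_one]
      _ = h.i * (h.m * z.toBlocks₂₁ * g.i) * g.m := by simp only [Matrix.mul_assoc]
      _ = 0 := by rw [hz]; simp
  · intro hz; rw [hz]; simp

theorem exists_but (G : MIso F (α ⊕ β) (γ ⊕ δ)) (hc : Fintype.card α = Fintype.card γ)
    (h0 : G.m.toBlocks₂₁ = 0) :
    ∃ g : MIso F α γ, ∃ h : MIso F β δ, ∃ v : Matrix α δ F, G = but g h v := by
  obtain ⟨m, i, mi, im⟩ := G
  simp only at h0
  have hcd : Fintype.card β = Fintype.card δ := by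
    have := Matrix.square_of_invertible m i mi im
    simp only [Fintype.card_sum] at this
    omega
  rw [← fromBlocks_toBlocks m, ← fromBlocks_toBlocks i, h0, fromBlocks_multiply,
    ← fromBlocks_one, fromBlocks_inj] at mi im
  simp only [Matrix.zero_mul, zero_add, Matrix.mul_zero, add_zero] at mi im
  have e1 : m.toBlocks₁₁ * i.toBlocks₁₁ = 1 := (Matrix.mul_eq_one_comm_of_card_eq _ _ _ hc.symm).1 im.1
  have e2 : i.toBlocks₂₂ * m.toBlocks₂₂ = 1 := (Matrix.mul_eq_one_comm_of_card_eq _ _ _ hcd).1 mi.2.2.2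
  refine ⟨⟨m.toBlocks₁₁, i.toBlocks₁₁, e1, im.1⟩, ⟨m.toBlocks₂₂, i.toBlocks₂₂, mi.2.2.2, e2⟩,
    m.toBlocks₁₂, ext_m ?_⟩
  simp only [but]
  rw [← h0, fromBlocks_toBlocks]

theorem but_inj {g g' : MIso F α γ} {h h' : MIso F β δ} {v v' : Matrix α δ F}
    (e : but g h v = but g' h' v') : g = g' ∧ h = h' ∧ v = v' := by
  have := congrArg MIso.m e
  simp only [but, fromBlocks_inj] at this
  exact ⟨ext_m this.1, ext_m this.2.2.2, this.2.1⟩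

end MIso

/-- Indicator of a proposition. -/
noncomputable def ind (p : Prop) : ℂ := if p then 1 else 0

theorem ind_true {p : Prop} (h : p) : ind p = 1 := if_pos h
theorem ind_false {p : Prop} (h : ¬ p) : ind p = 0 := if_neg h
theorem ind_and (p q : Prop) : ind (p ∧ q) = ind p * ind q := by
  unfold ind; split_ifs <;> simp_all
theorem ind_congr {p q : Prop} (h : p ↔ q) : ind p = ind q := by rw [propext h]

theorem sum_but (hc : Fintype.card α = Fintype.card γ) (f : MIso F (α ⊕ β) (γ ⊕ δ) → ℂ) :
    ∑ G : MIso F (α ⊕ β) (γ ⊕ δ), ind (G.m.toBlocks₂₁ = 0) * f G =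
      ∑ g : MIso F α γ, ∑ h : MIso F β δ, ∑ v : Matrix α δ F, f (MIso.but g h v) := by
  have h1 : ∑ g : MIso F α γ, ∑ h : MIso F β δ, ∑ v : Matrix α δ F, f (MIso.but g h v)
      = ∑ t : MIso F α γ × MIso F β δ × Matrix α δ F, f (MIso.but t.1 t.2.1 t.2.2) := by
    simp only [Fintype.sum_prod_type]
  rw [h1]
  symm
  have hinj : Function.Injective
      (fun t : MIso F α γ × MIso F β δ × Matrix α δ F => MIso.but t.1 t.2.1 t.2.2) := by
    rintro ⟨a, b, c⟩ ⟨a', b', c'⟩ h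
    obtain ⟨h1, h2, h3⟩ := MIso.but_inj h
    simp_all
  rw [← Finset.sum_image (s := Finset.univ) (f := f)
    (g := fun t : MIso F α γ × MIso F β δ × Matrix α δ F => MIso.but t.1 t.2.1 t.2.2)
    (fun x _ y _ h => hinj h)]
  rw [← Finset.sum_subset (Finset.subset_univ _)
    (f := fun G : MIso F (α ⊕ β) (γ ⊕ δ) => ind (G.m.toBlocks₂₁ = 0) * f G)
    (s₁ := Finset.univ.image
      (fun t : MIso F α γ × MIso F β δ × Matrix α δ F => MIso.but t.1 t.2.1 t.2.2))]
  · apply Finset.sum_congr rfl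
    intro G hG
    simp only [Finset.mem_image, Finset.mem_univ, true_and] at hG
    obtain ⟨t, rfl⟩ := hG
    rw [ind_true (by simp [MIso.but]), one_mul]
  · intro G _ hG
    rw [ind_false, zero_mul]
    intro h0
    obtain ⟨g, h, v, rfl⟩ := MIso.exists_but G hc h0
    exact hG (Finset.mem_image.2 ⟨(g, h, v), Finset.mem_univ _, rfl⟩)

/-- The order of the general linear group as a complex number. -/
noncomputable def NN (F : Type) [Field F] [Fintype F] [DecidableEq F]
    (α : Type) [Fintype α] [DecidableEq α] : ℂ :=
  (Fintype.card (MIso F α α) : ℂ)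

/-- The order of the field as a complex number. -/
noncomputable def qq (F : Type) [Fintype F] : ℂ := (Fintype.card F : ℂ)

theorem NN_ne : NN F α ≠ 0 := by
  unfold NN
  have : Nonempty (MIso F α α) := ⟨MIso.one F α⟩
  exact_mod_cast Fintype.card_ne_zero

theorem qq_ne : qq F ≠ 0 := by
  unfold qq
  exact_mod_cast Fintype.card_ne_zero

theorem card_MIso (h : Fintype.card α = Fintype.card β) :
    (Fintype.card (MIso F α β) : ℂ) = NN F α := by
  obtain ⟨G⟩ := MIso.exists_of_card (F := F) h
  unfold NN
  rw [Fintype.card_congr (MIso.compR (α := α) G)]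

theorem card_MIso' (h : Fintype.card α = Fintype.card β) :
    (Fintype.card (MIso F α β) : ℂ) = NN F β := by
  obtain ⟨G⟩ := MIso.exists_of_card (F := F) h
  unfold NN
  rw [Fintype.card_congr (MIso.compL (γ := β) G)]

theorem NN_congr (h : Fintype.card α = Fintype.card β) : NN F α = NN F β := by
  rw [← card_MIso h, card_MIso' h]

theorem card_Mat : (Fintype.card (Matrix α β F) : ℂ) = qq F ^ (Fintype.card α * Fintype.card β) := by
  have h : Fintype.card (Matrix α β F) = Fintype.card (α → β → F) :=
    Fintype.card_congr Matrix.of.symm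
  rw [h]
  unfold qq
  simp only [Fintype.card_fun]
  push_cast
  rw [← pow_mul, mul_comm]

theorem isEmpty_MIso (h : Fintype.card α ≠ Fintype.card β) : IsEmpty (MIso F α β) :=
  ⟨fun G => h G.card_eq⟩

/-- Invariance. -/
def Inv (f : Matrix α α F → ℂ) : Prop := ∀ (G : MIso F α α) (x : Matrix α α F), f (G.conj x) = f x

/-- Transport of an invariant function to another index type (zero when sizes differ). -/
noncomputable def TT (κ : Type) [Fintype κ] [DecidableEq κ] (f : Matrix α α F → ℂ)
    (x : Matrix κ κ F) : ℂ := (NN F α)⁻¹ * ∑ G : MIso F α κ, f (G.conj x)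

theorem TT_eq {f : Matrix α α F → ℂ} (hf : Inv f) (G : MIso F α κ) (x : Matrix κ κ F) :
    TT κ f x = f (G.conj x) := by
  unfold TT
  have : ∀ H : MIso F α κ, f (H.conj x) = f (G.conj x) := by
    intro H
    have h1 := hf (H.comp G.symm) (G.conj x)
    rw [MIso.comp_conj, MIso.symm_conj] at h1
    exact h1
  rw [Finset.sum_congr rfl (fun H _ => this H), Finset.sum_const, Finset.card_univ, nsmul_eq_mul,
    card_MIso G.card_eq, ← mul_assoc, inv_mul_cancel₀ NN_ne, one_mul]

theorem TT_self {f : Matrix α α F → ℂ} (hf : Inv f) (x : Matrix α α F) : TT α f x = f x := by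
  rw [TT_eq hf (MIso.one F α), MIso.one_conj]

theorem TT_zero (f : Matrix α α F → ℂ) (h : Fintype.card α ≠ Fintype.card κ) (x : Matrix κ κ F) :
    TT κ f x = 0 := by
  have := isEmpty_MIso (F := F) h
  simp [TT]

theorem TT_conj (f : Matrix α α F → ℂ) (G : MIso F κ ι) (x : Matrix ι ι F) :
    TT κ f (G.conj x) = TT ι f x := by
  unfold TT
  congr 1
  rw [← Equiv.sum_comp (MIso.compR (α := α) G)]
  apply Finset.sum_congr rfl
  intro H _
  rw [← MIso.comp_conj]; rfl

/-- Induction. -/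
noncomputable def Ind (α β ι : Type) [Fintype α] [DecidableEq α] [Fintype β] [DecidableEq β]
    [Fintype ι] [DecidableEq ι] (p : Matrix α α F → Matrix β β F → ℂ) (z : Matrix ι ι F) : ℂ :=
  (NN F α * NN F β * qq F ^ (Fintype.card α * Fintype.card β))⁻¹ *
    ∑ G : MIso F (α ⊕ β) ι, ind ((G.conj z).toBlocks₂₁ = 0) *
      p (G.conj z).toBlocks₁₁ (G.conj z).toBlocks₂₂

/-- Restriction. -/
noncomputable def Res (α β : Type) [Fintype α] [DecidableEq α] [Fintype β] [DecidableEq β]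
    (f : Matrix ι ι F → ℂ) (x : Matrix α α F) (y : Matrix β β F) : ℂ :=
  (qq F ^ (Fintype.card α * Fintype.card β))⁻¹ *
    ∑ u : Matrix α β F, TT (α ⊕ β) f (fromBlocks x u 0 y)

theorem Ind_zero_of_card (h : Fintype.card α + Fintype.card β ≠ Fintype.card ι)
    (p : Matrix α α F → Matrix β β F → ℂ) (z : Matrix ι ι F) : Ind α β ι p z = 0 := by
  have := isEmpty_MIso (F := F) (α := α ⊕ β) (β := ι) (by simpa using h)
  simp [Ind]

theorem Res_zero_of_card (h : Fintype.card α + Fintype.card β ≠ Fintype.card ι)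
    (f : Matrix ι ι F → ℂ) (x : Matrix α α F) (y : Matrix β β F) : Res α β f x y = 0 := by
  unfold Res
  rw [Finset.sum_eq_zero, mul_zero]
  intro u _
  apply TT_zero
  simpa using h.symm

theorem Ind_conj (p : Matrix α α F → Matrix β β F → ℂ) (G : MIso F κ ι) (z : Matrix ι ι F) :
    Ind α β κ p (G.conj z) = Ind α β ι p z := by
  unfold Ind
  congr 1
  rw [← Equiv.sum_comp (MIso.compR (α := α ⊕ β) G)]
  apply Finset.sum_congr rfl
  intro H _
  rw [← MIso.comp_conj]; rfl

theorem Ind_Inv (p : Matrix α α F → Matrix β β F → ℂ) : Inv (Ind α β ι p) :=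
  fun G x => Ind_conj p G x

theorem TT_Ind (p : Matrix α α F → Matrix β β F → ℂ)
    (h : Fintype.card ι = Fintype.card κ) (z : Matrix κ κ F) :
    TT κ (Ind α β ι p) z = Ind α β κ p z := by
  obtain ⟨G⟩ := MIso.exists_of_card (F := F) h
  rw [TT_eq (Ind_Inv p) G, Ind_conj]

theorem Res_conj (f : Matrix ι ι F → ℂ) (G : MIso F γ α) (H : MIso F δ β) (x : Matrix α α F)
    (y : Matrix β β F) : Res γ δ f (G.conj x) (H.conj y) = Res α β f x y := by
  unfold Res
  rw [G.card_eq, H.card_eq]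
  congr 1
  let e : Matrix α β F ≃ Matrix γ δ F :=
    ⟨fun u => G.m * u * H.i, fun u => G.i * u * H.m, fun u => by
      calc G.i * (G.m * u * H.i) * H.m = (G.i * G.m) * u * (H.i * H.m) := by
            simp only [Matrix.mul_assoc]
        _ = u := by rw [G.im, H.im, Matrix.one_mul, Matrix.mul_one], fun u => by
      calc G.m * (G.i * u * H.m) * H.i = (G.m * G.i) * u * (H.m * H.i) := by
            simp only [Matrix.mul_assoc]
        _ = u := by rw [G.mi, H.mi, Matrix.one_mul, Matrix.mul_one]⟩
  rw [← Equiv.sum_comp e]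
  apply Finset.sum_congr rfl
  intro u _
  rw [← TT_conj f (MIso.but G H 0), MIso.but_conj]
  simp [e]

theorem Res_Inv_right (f : Matrix ι ι F → ℂ) (x : Matrix α α F) : Inv (Res α β f x) := by
  intro G y
  have := Res_conj f (MIso.one F α) G x y
  rwa [MIso.one_conj] at this

theorem Res_Inv_left (f : Matrix ι ι F → ℂ) (y : Matrix β β F) :
    Inv (fun x : Matrix α α F => Res α β f x y) := by
  intro G x
  have := Res_conj f G (MIso.one F β) x y
  rwa [MIso.one_conj] at this

end MIsoBasics

section Assoc

variable {α β γ δ ι κ : Type} [Fintype α] [DecidableEq α] [Fintype β] [DecidableEq β]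
  [Fintype γ] [DecidableEq γ] [Fintype δ] [DecidableEq δ] [Fintype ι] [DecidableEq ι]
  [Fintype κ] [DecidableEq κ]

theorem but_ind (g : MIso F α γ) (h : MIso F β δ) (v : Matrix α δ F)
    (z : Matrix (γ ⊕ δ) (γ ⊕ δ) F) (ψ : Matrix α α F → Matrix β β F → ℂ) :
    ind (((MIso.but g h v).conj z).toBlocks₂₁ = 0) *
      ψ ((MIso.but g h v).conj z).toBlocks₁₁ ((MIso.but g h v).conj z).toBlocks₂₂ =
    ind (z.toBlocks₂₁ = 0) * ψ (g.conj z.toBlocks₁₁) (h.conj z.toBlocks₂₂) := by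
  by_cases hz : z.toBlocks₂₁ = 0
  · rw [ind_true hz, ind_true ((MIso.but_conj_21 g h v z).2 hz)]
    have : z = fromBlocks z.toBlocks₁₁ z.toBlocks₁₂ 0 z.toBlocks₂₂ := by
      rw [← hz, fromBlocks_toBlocks]
    conv_lhs => rw [this]
    rw [MIso.but_conj]
    simp
  · rw [ind_false hz, ind_false (fun h' => hz ((MIso.but_conj_21 g h v z).1 h'))]
    simp

/-- Threefold induction. -/
noncomputable def Ind3 (α β γ ι : Type) [Fintype α] [DecidableEq α] [Fintype β] [DecidableEq β]
    [Fintype γ] [DecidableEq γ] [Fintype ι] [DecidableEq ι]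
    (p : Matrix α α F → Matrix β β F → Matrix γ γ F → ℂ) (z : Matrix ι ι F) : ℂ :=
  (NN F α * NN F β * NN F γ * qq F ^ (Fintype.card α * Fintype.card β +
      Fintype.card α * Fintype.card γ + Fintype.card β * Fintype.card γ))⁻¹ *
    ∑ G : MIso F (α ⊕ (β ⊕ γ)) ι, ind ((G.conj z).toBlocks₂₁ = 0) *
      (ind ((G.conj z).toBlocks₂₂.toBlocks₂₁ = 0) *
      p (G.conj z).toBlocks₁₁ (G.conj z).toBlocks₂₂.toBlocks₁₁ (G.conj z).toBlocks₂₂.toBlocks₂₂)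

theorem Ind3_zero_of_card
    (h : Fintype.card α + (Fintype.card β + Fintype.card γ) ≠ Fintype.card ι)
    (p : Matrix α α F → Matrix β β F → Matrix γ γ F → ℂ) (z : Matrix ι ι F) :
    Ind3 α β γ ι p z = 0 := by
  have := isEmpty_MIso (F := F) (α := α ⊕ (β ⊕ γ)) (β := ι) (by simpa using h)
  simp [Ind3]

theorem assocR (hc : Fintype.card β + Fintype.card γ = Fintype.card κ)
    (p : Matrix α α F → Matrix β β F → Matrix γ γ F → ℂ) (z : Matrix ι ι F) :
    Ind α κ ι (fun x y => Ind β γ κ (p x) y) z = Ind3 α β γ ι p z := by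
  unfold Ind Ind3
  have hc' : Fintype.card (β ⊕ γ) = Fintype.card κ := by simpa using hc
  set S := ∑ G : MIso F (α ⊕ (β ⊕ γ)) ι, ind ((G.conj z).toBlocks₂₁ = 0) *
      (ind ((G.conj z).toBlocks₂₂.toBlocks₂₁ = 0) *
      p (G.conj z).toBlocks₁₁ (G.conj z).toBlocks₂₂.toBlocks₁₁
        (G.conj z).toBlocks₂₂.toBlocks₂₂) with hS
  have key : ∀ H : MIso F (β ⊕ γ) κ,
      ∑ G : MIso F (α ⊕ κ) ι, ind ((G.conj z).toBlocks₂₁ = 0) *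
        (ind ((H.conj (G.conj z).toBlocks₂₂).toBlocks₂₁ = 0) *
          p (G.conj z).toBlocks₁₁ (H.conj (G.conj z).toBlocks₂₂).toBlocks₁₁
            (H.conj (G.conj z).toBlocks₂₂).toBlocks₂₂) = S := by
    intro H
    rw [hS, ← Equiv.sum_comp (MIso.compL (MIso.but (MIso.one F α) H 0))]
    apply Finset.sum_congr rfl
    intro G _
    have := but_ind (MIso.one F α) H 0 (G.conj z)
      (fun x w => ind (w.toBlocks₂₁ = 0) * p x w.toBlocks₁₁ w.toBlocks₂₂)
    rw [MIso.one_conj, ← MIso.comp_conj] at this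
    exact this.symm
  have h2 : ∑ G : MIso F (α ⊕ κ) ι, ind ((G.conj z).toBlocks₂₁ = 0) *
      ((NN F β * NN F γ * qq F ^ (Fintype.card β * Fintype.card γ))⁻¹ *
        ∑ H : MIso F (β ⊕ γ) κ, ind ((H.conj (G.conj z).toBlocks₂₂).toBlocks₂₁ = 0) *
          p (G.conj z).toBlocks₁₁ (H.conj (G.conj z).toBlocks₂₂).toBlocks₁₁
            (H.conj (G.conj z).toBlocks₂₂).toBlocks₂₂) =
      (NN F β * NN F γ * qq F ^ (Fintype.card β * Fintype.card γ))⁻¹ * (NN F κ * S) := by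
    have hh : ∑ _H : MIso F (β ⊕ γ) κ, S = NN F κ * S := by
      rw [Finset.sum_const, Finset.card_univ, nsmul_eq_mul, card_MIso' hc']
    rw [← hh, ← Finset.sum_congr rfl (fun H _ => key H), Finset.sum_comm, Finset.mul_sum]
    apply Finset.sum_congr rfl
    intro G _
    rw [← Finset.mul_sum]; ring
  rw [h2, ← hc]
  have := NN_ne (F := F) (α := α)
  have := NN_ne (F := F) (α := β)
  have := NN_ne (F := F) (α := γ)
  have := NN_ne (F := F) (α := κ)
  have := qq_ne (F := F)
  have e : qq F ^ (Fintype.card α * Fintype.card β +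
      Fintype.card α * Fintype.card γ + Fintype.card β * Fintype.card γ) =
      qq F ^ (Fintype.card α * (Fintype.card β + Fintype.card γ)) *
        qq F ^ (Fintype.card β * Fintype.card γ) := by
    rw [← pow_add]; congr 1; ring
  rw [e]
  field_simp

theorem assoc_block (p : Matrix α α F → Matrix β β F → Matrix γ γ F → ℂ)
    (M : Matrix (α ⊕ (β ⊕ γ)) (α ⊕ (β ⊕ γ)) F) :
    ind ((M.submatrix (Equiv.sumAssoc α β γ) (Equiv.sumAssoc α β γ)).toBlocks₂₁ = 0) *
      (ind ((M.submatrix (Equiv.sumAssoc α β γ) (Equiv.sumAssoc α β γ)).toBlocks₁₁.toBlocks₂₁ = 0) *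
      p (M.submatrix (Equiv.sumAssoc α β γ) (Equiv.sumAssoc α β γ)).toBlocks₁₁.toBlocks₁₁
        (M.submatrix (Equiv.sumAssoc α β γ) (Equiv.sumAssoc α β γ)).toBlocks₁₁.toBlocks₂₂
        (M.submatrix (Equiv.sumAssoc α β γ) (Equiv.sumAssoc α β γ)).toBlocks₂₂) =
    ind (M.toBlocks₂₁ = 0) * (ind (M.toBlocks₂₂.toBlocks₂₁ = 0) *
      p M.toBlocks₁₁ M.toBlocks₂₂.toBlocks₁₁ M.toBlocks₂₂.toBlocks₂₂) := by
  have hcond : ((M.submatrix (Equiv.sumAssoc α β γ) (Equiv.sumAssoc α β γ)).toBlocks₂₁ = 0 ∧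
      (M.submatrix (Equiv.sumAssoc α β γ) (Equiv.sumAssoc α β γ)).toBlocks₁₁.toBlocks₂₁ = 0) ↔
      (M.toBlocks₂₁ = 0 ∧ M.toBlocks₂₂.toBlocks₂₁ = 0) := by
    simp only [← Matrix.ext_iff, toBlocks₂₁, toBlocks₁₁, toBlocks₂₂, Matrix.of_apply,
      Matrix.submatrix_apply, Sum.forall, Matrix.zero_apply, Equiv.sumAssoc_apply_inl_inl,
      Equiv.sumAssoc_apply_inl_inr, Equiv.sumAssoc_apply_inr]
    exact ⟨fun ⟨h1, h2⟩ => ⟨⟨h2, fun c a => (h1 c).1 a⟩, fun c b => (h1 c).2 b⟩,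
      fun ⟨⟨h2, h3⟩, h4⟩ => ⟨fun c => ⟨h3 c, h4 c⟩, h2⟩⟩
  have e := ind_congr hcond
  rw [ind_and, ind_and] at e
  rw [← mul_assoc, ← mul_assoc, e]
  rfl

theorem assocL (hc : Fintype.card α + Fintype.card β = Fintype.card κ)
    (p : Matrix α α F → Matrix β β F → Matrix γ γ F → ℂ) (z : Matrix ι ι F) :
    Ind κ γ ι (fun w y => Ind α β κ (fun a b => p a b y) w) z = Ind3 α β γ ι p z := by
  unfold Ind Ind3
  have hc' : Fintype.card (α ⊕ β) = Fintype.card κ := by simpa using hc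
  set S := ∑ G : MIso F (α ⊕ (β ⊕ γ)) ι, ind ((G.conj z).toBlocks₂₁ = 0) *
      (ind ((G.conj z).toBlocks₂₂.toBlocks₂₁ = 0) *
      p (G.conj z).toBlocks₁₁ (G.conj z).toBlocks₂₂.toBlocks₁₁
        (G.conj z).toBlocks₂₂.toBlocks₂₂) with hS
  have hS' : ∑ G : MIso F ((α ⊕ β) ⊕ γ) ι, ind ((G.conj z).toBlocks₂₁ = 0) *
      (ind ((G.conj z).toBlocks₁₁.toBlocks₂₁ = 0) *
      p (G.conj z).toBlocks₁₁.toBlocks₁₁ (G.conj z).toBlocks₁₁.toBlocks₂₂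
        (G.conj z).toBlocks₂₂) = S := by
    rw [hS, ← Equiv.sum_comp (MIso.compL (MIso.ofEquiv F (Equiv.sumAssoc α β γ)))]
    apply Finset.sum_congr rfl
    intro G _
    have : (MIso.compL (MIso.ofEquiv F (Equiv.sumAssoc α β γ)) G).conj z =
        (G.conj z).submatrix (Equiv.sumAssoc α β γ) (Equiv.sumAssoc α β γ) := by
      rw [← MIso.ofEquiv_conj, ← MIso.comp_conj]; rfl
    rw [this]
    exact assoc_block p (G.conj z)
  have key : ∀ H : MIso F (α ⊕ β) κ,
      ∑ G : MIso F (κ ⊕ γ) ι, ind ((G.conj z).toBlocks₂₁ = 0) *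
        (ind ((H.conj (G.conj z).toBlocks₁₁).toBlocks₂₁ = 0) *
          p (H.conj (G.conj z).toBlocks₁₁).toBlocks₁₁ (H.conj (G.conj z).toBlocks₁₁).toBlocks₂₂
            (G.conj z).toBlocks₂₂) = S := by
    intro H
    rw [← hS', ← Equiv.sum_comp (MIso.compL (MIso.but H (MIso.one F γ) 0))]
    apply Finset.sum_congr rfl
    intro G _
    have := but_ind H (MIso.one F γ) 0 (G.conj z)
      (fun w y => ind (w.toBlocks₂₁ = 0) * p w.toBlocks₁₁ w.toBlocks₂₂ y)
    rw [MIso.one_conj, ← MIso.comp_conj] at this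
    exact this.symm
  have h2 : ∑ G : MIso F (κ ⊕ γ) ι, ind ((G.conj z).toBlocks₂₁ = 0) *
      ((NN F α * NN F β * qq F ^ (Fintype.card α * Fintype.card β))⁻¹ *
        ∑ H : MIso F (α ⊕ β) κ, ind ((H.conj (G.conj z).toBlocks₁₁).toBlocks₂₁ = 0) *
          p (H.conj (G.conj z).toBlocks₁₁).toBlocks₁₁ (H.conj (G.conj z).toBlocks₁₁).toBlocks₂₂
            (G.conj z).toBlocks₂₂) =
      (NN F α * NN F β * qq F ^ (Fintype.card α * Fintype.card β))⁻¹ * (NN F κ * S) := by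
    have hh : ∑ _H : MIso F (α ⊕ β) κ, S = NN F κ * S := by
      rw [Finset.sum_const, Finset.card_univ, nsmul_eq_mul, card_MIso' hc']
    rw [← hh, ← Finset.sum_congr rfl (fun H _ => key H), Finset.sum_comm, Finset.mul_sum]
    apply Finset.sum_congr rfl
    intro G _
    rw [← Finset.mul_sum]; ring
  rw [h2, ← hc]
  have := NN_ne (F := F) (α := α)
  have := NN_ne (F := F) (α := β)
  have := NN_ne (F := F) (α := γ)
  have := NN_ne (F := F) (α := κ)
  have := qq_ne (F := F)
  have e : qq F ^ (Fintype.card α * Fintype.card β +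
      Fintype.card α * Fintype.card γ + Fintype.card β * Fintype.card γ) =
      qq F ^ ((Fintype.card α + Fintype.card β) * Fintype.card γ) *
        qq F ^ (Fintype.card α * Fintype.card β) := by
    rw [← pow_add]; congr 1; ring
  rw [e]
  field_simp

/-- sum over all block matrices -/
theorem sum_blocks (f : Matrix (α ⊕ β) (γ ⊕ δ) F → ℂ) :
    ∑ M : Matrix (α ⊕ β) (γ ⊕ δ) F, f M =
      ∑ a : Matrix α γ F, ∑ b : Matrix α δ F, ∑ c : Matrix β γ F, ∑ d : Matrix β δ F,
        f (fromBlocks a b c d) := by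
  let e : (Matrix α γ F × Matrix α δ F × Matrix β γ F × Matrix β δ F) ≃
      Matrix (α ⊕ β) (γ ⊕ δ) F :=
    ⟨fun t => fromBlocks t.1 t.2.1 t.2.2.1 t.2.2.2,
     fun M => (M.toBlocks₁₁, M.toBlocks₁₂, M.toBlocks₂₁, M.toBlocks₂₂),
     fun t => by simp, fun M => fromBlocks_toBlocks M⟩
  rw [← Equiv.sum_comp e]
  simp only [Fintype.sum_prod_type]
  rfl

theorem sum_ind_eq_zero (f : Matrix α β F → ℂ) :
    ∑ c : Matrix α β F, ind (c = 0) * f c = f 0 := by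
  rw [Finset.sum_eq_single 0]
  · rw [ind_true rfl, one_mul]
  · intro b _ hb; rw [ind_false hb, zero_mul]
  · simp

theorem adjunction (hc : Fintype.card α + Fintype.card β = Fintype.card ι)
    (p : Matrix α α F → Matrix β β F → ℂ) {c : Matrix ι ι F → ℂ} (hinv : Inv c) :
    ∑ z : Matrix ι ι F, Ind α β ι p z * c z =
      (NN F ι * (NN F α * NN F β)⁻¹) *
        ∑ x : Matrix α α F, ∑ y : Matrix β β F, p x y * Res α β c x y := by
  have hc' : Fintype.card (α ⊕ β) = Fintype.card ι := by simpa using hc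
  unfold Ind Res
  have key : ∀ G : MIso F (α ⊕ β) ι, ∑ z : Matrix ι ι F, ind ((G.conj z).toBlocks₂₁ = 0) *
      p (G.conj z).toBlocks₁₁ (G.conj z).toBlocks₂₂ * c z =
      ∑ x : Matrix α α F, ∑ y : Matrix β β F, p x y *
        ∑ u : Matrix α β F, TT (α ⊕ β) c (fromBlocks x u 0 y) := by
    intro G
    have : ∀ z : Matrix ι ι F, c z = TT (α ⊕ β) c (G.conj z) := by
      intro z; rw [TT_conj, TT_self hinv]
    simp_rw [this]
    have h3 := Equiv.sum_comp G.conjE (fun w : Matrix (α ⊕ β) (α ⊕ β) F =>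
      ind (w.toBlocks₂₁ = 0) * p w.toBlocks₁₁ w.toBlocks₂₂ * TT (α ⊕ β) c w)
    refine h3.trans ?_
    rw [sum_blocks]
    simp only [toBlocks_fromBlocks₁₁, toBlocks_fromBlocks₂₁, toBlocks_fromBlocks₂₂]
    apply Finset.sum_congr rfl
    intro x _
    simp_rw [mul_assoc, ← Finset.mul_sum]
    simp_rw [sum_ind_eq_zero (fun c' : Matrix β α F => ∑ i : Matrix β β F, p x i * TT (α ⊕ β) c (fromBlocks x _ c' i))]
    rw [Finset.sum_comm]
    simp_rw [Finset.mul_sum]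
  simp_rw [mul_assoc, ← Finset.mul_sum, Finset.sum_mul]
  rw [Finset.sum_comm, Finset.sum_congr rfl (fun G _ => key G), Finset.sum_const, Finset.card_univ,
    nsmul_eq_mul, card_MIso' hc']
  have e : ∀ (x : Matrix α α F) (y : Matrix β β F), p x y *
      ((qq F ^ (Fintype.card α * Fintype.card β))⁻¹ *
        ∑ u : Matrix α β F, TT (α ⊕ β) c (fromBlocks x u 0 y)) =
      (qq F ^ (Fintype.card α * Fintype.card β))⁻¹ * (p x y *
        ∑ u : Matrix α β F, TT (α ⊕ β) c (fromBlocks x u 0 y)) := by intros; ring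
  simp_rw [e, ← Finset.mul_sum]
  rw [mul_inv, mul_inv]
  ring

theorem NN_empty [IsEmpty α] : NN F α = 1 := by
  unfold NN
  have : Unique (MIso F α α) := ⟨⟨MIso.one F α⟩, fun G => MIso.ext_m (Subsingleton.elim _ _)⟩
  rw [Fintype.card_unique]; simp

theorem Ind_right_empty [IsEmpty β] (p : Matrix α α F → Matrix β β F → ℂ) (z : Matrix ι ι F) :
    Ind α β ι p z = TT ι (fun x => p x 0) z := by
  unfold Ind TT
  rw [NN_empty (α := β)]
  simp only [Fintype.card_eq_zero, mul_zero, pow_zero, mul_one]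
  congr 1
  rw [← Equiv.sum_comp (MIso.compL (MIso.ofEquiv F (Equiv.sumEmpty α β).symm))]
  apply Finset.sum_congr rfl
  intro G _
  have : (MIso.compL (MIso.ofEquiv F (Equiv.sumEmpty α β).symm) G).conj z =
      (G.conj z).submatrix (Equiv.sumEmpty α β).symm (Equiv.sumEmpty α β).symm := by
    rw [← MIso.ofEquiv_conj, ← MIso.comp_conj]; rfl
  rw [this, ind_true (Subsingleton.elim _ _), one_mul]
  congr 1
  exact Subsingleton.elim _ _

theorem Ind_left_empty [IsEmpty α] (p : Matrix α α F → Matrix β β F → ℂ) (z : Matrix ι ι F) :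
    Ind α β ι p z = TT ι (fun y => p 0 y) z := by
  unfold Ind TT
  rw [NN_empty (α := α)]
  simp only [Fintype.card_eq_zero, zero_mul, pow_zero, mul_one, one_mul]
  congr 1
  rw [← Equiv.sum_comp (MIso.compL (MIso.ofEquiv F (Equiv.emptySum α β).symm))]
  apply Finset.sum_congr rfl
  intro G _
  have : (MIso.compL (MIso.ofEquiv F (Equiv.emptySum α β).symm) G).conj z =
      (G.conj z).submatrix (Equiv.emptySum α β).symm (Equiv.emptySum α β).symm := by
    rw [← MIso.ofEquiv_conj, ← MIso.comp_conj]; rfl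
  rw [this, ind_true (Subsingleton.elim _ _), one_mul]
  congr 1
  exact Subsingleton.elim _ _

theorem Res_right_empty [IsEmpty β] (f : Matrix ι ι F → ℂ) (x : Matrix α α F) (y : Matrix β β F) :
    Res α β f x y = TT α f x := by
  unfold Res
  simp only [Fintype.card_eq_zero, mul_zero, pow_zero, inv_one, one_mul]
  rw [Fintype.sum_subsingleton _ (0 : Matrix α β F), ← TT_conj f (MIso.ofEquiv F (Equiv.sumEmpty α β)) x, MIso.ofEquiv_conj]
  congr 1
  ext i j
  rcases i with i | i
  · rcases j with j | j
    · rfl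
    · exact isEmptyElim j
  · exact isEmptyElim i

theorem Res_left_empty [IsEmpty α] (f : Matrix ι ι F → ℂ) (x : Matrix α α F) (y : Matrix β β F) :
    Res α β f x y = TT β f y := by
  unfold Res
  simp only [Fintype.card_eq_zero, zero_mul, pow_zero, inv_one, one_mul]
  rw [Fintype.sum_subsingleton _ (0 : Matrix α β F), ← TT_conj f (MIso.ofEquiv F (Equiv.emptySum α β)) y, MIso.ofEquiv_conj]
  congr 1
  ext i j
  rcases i with i | i
  · exact isEmptyElim i
  · rcases j with j | j
    · exact isEmptyElim j
    · rfl

end Assoc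

section Mackey

variable {α β γ δ ι κ α' β' : Type} [Fintype α] [DecidableEq α] [Fintype β] [DecidableEq β]
  [Fintype γ] [DecidableEq γ] [Fintype δ] [DecidableEq δ] [Fintype ι] [DecidableEq ι]
  [Fintype κ] [DecidableEq κ] [Fintype α'] [DecidableEq α'] [Fintype β'] [DecidableEq β']

/-- Being block upper triangular. -/
def BU (G : MIso F (α ⊕ β) (γ ⊕ δ)) : Prop := G.m.toBlocks₂₁ = 0

theorem BU_but (g : MIso F α γ) (h : MIso F β δ) (v : Matrix α δ F) : BU (MIso.but g h v) := by
  simp [BU, MIso.but]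

theorem MIso_mul_left_eq_zero (g : MIso F α β) (M : Matrix β γ F) : g.m * M = 0 ↔ M = 0 := by
  constructor
  · intro h
    calc M = g.i * (g.m * M) := by rw [← Matrix.mul_assoc, g.im, Matrix.one_mul]
      _ = 0 := by rw [h, Matrix.mul_zero]
  · intro h; rw [h, Matrix.mul_zero]

theorem MIso_mul_right_eq_zero (g : MIso F α β) (M : Matrix γ α F) : M * g.m = 0 ↔ M = 0 := by
  constructor
  · intro h
    calc M = (M * g.m) * g.i := by rw [Matrix.mul_assoc, g.mi, Matrix.mul_one]
      _ = 0 := by rw [h, Matrix.zero_mul]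
  · intro h; rw [h, Matrix.zero_mul]

theorem BU_comp_left (P : MIso F (α ⊕ β) (γ ⊕ δ)) (hc : Fintype.card α = Fintype.card γ)
    (hP : BU P) (R : MIso F (γ ⊕ δ) (α' ⊕ β')) : BU (P.comp R) ↔ BU R := by
  obtain ⟨g, h, v, rfl⟩ := MIso.exists_but P hc hP
  have : ((MIso.but g h v).comp R).m.toBlocks₂₁ = h.m * R.m.toBlocks₂₁ := by
    have : R.m = fromBlocks R.m.toBlocks₁₁ R.m.toBlocks₁₂ R.m.toBlocks₂₁ R.m.toBlocks₂₂ :=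
      (fromBlocks_toBlocks _).symm
    simp only [MIso.comp, MIso.but]
    conv_lhs => rw [this]
    rw [fromBlocks_multiply]; simp
  unfold BU
  rw [this, MIso_mul_left_eq_zero]

theorem BU_comp_right (P : MIso F (α ⊕ β) (γ ⊕ δ)) (hc : Fintype.card α = Fintype.card γ)
    (hP : BU P) (R : MIso F (α' ⊕ β') (α ⊕ β)) : BU (R.comp P) ↔ BU R := by
  obtain ⟨g, h, v, rfl⟩ := MIso.exists_but P hc hP
  have : (R.comp (MIso.but g h v)).m.toBlocks₂₁ = R.m.toBlocks₂₁ * g.m := by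
    have : R.m = fromBlocks R.m.toBlocks₁₁ R.m.toBlocks₁₂ R.m.toBlocks₂₁ R.m.toBlocks₂₂ :=
      (fromBlocks_toBlocks _).symm
    simp only [MIso.comp, MIso.but]
    conv_lhs => rw [this]
    rw [fromBlocks_multiply]; simp
  unfold BU
  rw [this, MIso_mul_right_eq_zero]

theorem BU_symm (P : MIso F (α ⊕ β) (γ ⊕ δ)) (hc : Fintype.card α = Fintype.card γ)
    (hP : BU P) : BU P.symm := by
  obtain ⟨g, h, v, rfl⟩ := MIso.exists_but P hc hP
  simp [BU, MIso.but, MIso.symm]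

variable {γ₁ γ₂ δ₁ δ₂ : Type} [Fintype γ₁] [DecidableEq γ₁] [Fintype γ₂] [DecidableEq γ₂]
  [Fintype δ₁] [DecidableEq δ₁] [Fintype δ₂] [DecidableEq δ₂]

/-- The swap of the two middle blocks. -/
def sw (F : Type) [Field F] (γ₁ γ₂ δ₁ δ₂ : Type) [Fintype γ₁] [DecidableEq γ₁] [Fintype γ₂]
    [DecidableEq γ₂] [Fintype δ₁] [DecidableEq δ₁] [Fintype δ₂] [DecidableEq δ₂] :
    MIso F ((γ₁ ⊕ δ₁) ⊕ (γ₂ ⊕ δ₂)) ((γ₁ ⊕ γ₂) ⊕ (δ₁ ⊕ δ₂)) :=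
  MIso.ofEquiv F (Equiv.sumSumSumComm γ₁ δ₁ γ₂ δ₂)

/-- The incidence relation between `G` and `Q`. -/
def Rel (G : MIso F (α ⊕ β) (γ ⊕ δ)) (Q : MIso F ((γ₁ ⊕ γ₂) ⊕ (δ₁ ⊕ δ₂)) (γ ⊕ δ)) : Prop :=
  BU Q ∧ BU (G.comp ((sw F γ₁ γ₂ δ₁ δ₂).comp Q).symm)

/-- order of a parabolic subgroup -/
noncomputable def PP (F : Type) [Field F] [Fintype F] [DecidableEq F] (α β : Type) [Fintype α]
    [DecidableEq α] [Fintype β] [DecidableEq β] : ℂ :=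
  NN F α * NN F β * qq F ^ (Fintype.card α * Fintype.card β)

theorem PP_ne : PP F α β ≠ 0 :=
  mul_ne_zero (mul_ne_zero NN_ne NN_ne) (pow_ne_zero _ qq_ne)

theorem sum_BU_one (hc : Fintype.card α = Fintype.card γ) (hd : Fintype.card β = Fintype.card δ) :
    ∑ G : MIso F (α ⊕ β) (γ ⊕ δ), ind (BU G) = PP F α β := by
  have := sum_but (F := F) (β := β) (δ := δ) hc (fun _ => 1)
  simp only [mul_one] at this
  unfold BU
  rw [this]
  simp only [Finset.sum_const, Finset.card_univ, nsmul_eq_mul, mul_one, card_MIso hc, card_MIso hd,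
    card_Mat, PP, hd]
  ring

/-- order of the stabiliser -/
noncomputable def SS (F : Type) [Field F] [Fintype F] [DecidableEq F] (γ₁ γ₂ δ₁ δ₂ : Type)
    [Fintype γ₁] [DecidableEq γ₁] [Fintype γ₂]
    [DecidableEq γ₂] [Fintype δ₁] [DecidableEq δ₁] [Fintype δ₂] [DecidableEq δ₂] : ℂ :=
  PP F γ₁ γ₂ * PP F δ₁ δ₂ * (qq F ^ (Fintype.card γ₁ * Fintype.card δ₁) *
    (qq F ^ (Fintype.card γ₁ * Fintype.card δ₂) * qq F ^ (Fintype.card γ₂ * Fintype.card δ₂)))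

theorem SS_ne : SS F γ₁ γ₂ δ₁ δ₂ ≠ 0 := by
  unfold SS
  have := qq_ne (F := F)
  exact mul_ne_zero (mul_ne_zero PP_ne PP_ne) (by positivity)

theorem sw_conj (M : Matrix ((γ₁ ⊕ γ₂) ⊕ (δ₁ ⊕ δ₂)) ((γ₁ ⊕ γ₂) ⊕ (δ₁ ⊕ δ₂)) F) :
    (sw F γ₁ γ₂ δ₁ δ₂).conj M = M.submatrix (Equiv.sumSumSumComm γ₁ δ₁ γ₂ δ₂)
      (Equiv.sumSumSumComm γ₁ δ₁ γ₂ δ₂) := MIso.ofEquiv_conj _ _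

theorem sw_conj_blocks (x : Matrix (γ₁ ⊕ γ₂) (γ₁ ⊕ γ₂) F) (u : Matrix (γ₁ ⊕ γ₂) (δ₁ ⊕ δ₂) F)
    (y : Matrix (δ₁ ⊕ δ₂) (δ₁ ⊕ δ₂) F) :
    (sw F γ₁ γ₂ δ₁ δ₂).conj (fromBlocks x u 0 y) =
      fromBlocks (fromBlocks x.toBlocks₁₁ u.toBlocks₁₁ 0 y.toBlocks₁₁)
        (fromBlocks x.toBlocks₁₂ u.toBlocks₁₂ 0 y.toBlocks₁₂)
        (fromBlocks x.toBlocks₂₁ u.toBlocks₂₁ 0 y.toBlocks₂₁)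
        (fromBlocks x.toBlocks₂₂ u.toBlocks₂₂ 0 y.toBlocks₂₂) := by
  rw [sw_conj]
  ext i j
  rcases i with (i | i) | (i | i) <;> rcases j with (j | j) | (j | j) <;> rfl

theorem fromBlocks_zero_iff (a : Matrix α γ F) (b : Matrix α δ F) (c : Matrix β γ F)
    (d : Matrix β δ F) : fromBlocks a b c d = 0 ↔ a = 0 ∧ b = 0 ∧ c = 0 ∧ d = 0 := by
  rw [← fromBlocks_zero, fromBlocks_inj]

theorem sum_S : ∑ S : MIso F ((γ₁ ⊕ γ₂) ⊕ (δ₁ ⊕ δ₂)) ((γ₁ ⊕ γ₂) ⊕ (δ₁ ⊕ δ₂)),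
    ind (BU S) * ind (BU ((sw F γ₁ γ₂ δ₁ δ₂).comp (S.comp (sw F γ₁ γ₂ δ₁ δ₂).symm))) =
      SS F γ₁ γ₂ δ₁ δ₂ := by
  have h := sum_but (F := F) (α := γ₁ ⊕ γ₂) (β := δ₁ ⊕ δ₂) (γ := γ₁ ⊕ γ₂) (δ := δ₁ ⊕ δ₂) rfl
    (fun S => ind (BU ((sw F γ₁ γ₂ δ₁ δ₂).comp (S.comp (sw F γ₁ γ₂ δ₁ δ₂).symm))))
  refine h.trans ?_
  have e : ∀ (g : MIso F (γ₁ ⊕ γ₂) (γ₁ ⊕ γ₂)) (h : MIso F (δ₁ ⊕ δ₂) (δ₁ ⊕ δ₂))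
      (v : Matrix (γ₁ ⊕ γ₂) (δ₁ ⊕ δ₂) F),
      ind (BU ((sw F γ₁ γ₂ δ₁ δ₂).comp ((MIso.but g h v).comp (sw F γ₁ γ₂ δ₁ δ₂).symm))) =
        ind (BU g) * (ind (BU h) * ind (v.toBlocks₂₁ = 0)) := by
    intro g h v
    rw [← ind_and, ← ind_and]
    apply ind_congr
    have : ((sw F γ₁ γ₂ δ₁ δ₂).comp ((MIso.but g h v).comp (sw F γ₁ γ₂ δ₁ δ₂).symm)).m =
        (sw F γ₁ γ₂ δ₁ δ₂).conj (fromBlocks g.m v 0 h.m) := by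
      simp only [MIso.comp, MIso.conj, MIso.symm, MIso.but, Matrix.mul_assoc]
    unfold BU
    rw [this, sw_conj_blocks, toBlocks_fromBlocks₂₁, fromBlocks_zero_iff]
    tauto
  simp_rw [e, ← Finset.mul_sum, ← Finset.sum_mul]
  rw [sum_BU_one rfl rfl, sum_BU_one rfl rfl, sum_blocks]
  simp only [toBlocks_fromBlocks₂₁, Finset.sum_const, nsmul_eq_mul, ← Finset.mul_sum, Finset.card_univ]
  have := sum_ind_eq_zero (F := F) (α := γ₂) (β := δ₁) (fun _ => 1)
  simp only [mul_one] at this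
  simp only [this, card_Mat, SS]
  ring

theorem Rel_iff {G : MIso F (α ⊕ β) (γ ⊕ δ)} {Q₀ : MIso F ((γ₁ ⊕ γ₂) ⊕ (δ₁ ⊕ δ₂)) (γ ⊕ δ)}
    (h1 : Fintype.card γ₁ + Fintype.card γ₂ = Fintype.card γ)
    (h3 : Fintype.card γ₁ + Fintype.card δ₁ = Fintype.card α)
    (h : Rel G Q₀) (S : MIso F ((γ₁ ⊕ γ₂) ⊕ (δ₁ ⊕ δ₂)) ((γ₁ ⊕ γ₂) ⊕ (δ₁ ⊕ δ₂))) :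
    Rel G (S.symm.comp Q₀) ↔
      (BU S ∧ BU ((sw F γ₁ γ₂ δ₁ δ₂).comp (S.comp (sw F γ₁ γ₂ δ₁ δ₂).symm))) := by
  unfold Rel
  apply and_congr
  · rw [BU_comp_right Q₀ (by simpa using h1) h.1]
    exact ⟨fun h => BU_symm S.symm rfl h, fun h => BU_symm S rfl h⟩
  · have e : G.comp ((sw F γ₁ γ₂ δ₁ δ₂).comp (S.symm.comp Q₀)).symm =
        (G.comp ((sw F γ₁ γ₂ δ₁ δ₂).comp Q₀).symm).comp
          ((sw F γ₁ γ₂ δ₁ δ₂).comp (S.comp (sw F γ₁ γ₂ δ₁ δ₂).symm)) := by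
      apply MIso.ext_m
      simp only [MIso.comp, MIso.symm]
      have hs : ∀ M : Matrix ((γ₁ ⊕ γ₂) ⊕ (δ₁ ⊕ δ₂)) ((γ₁ ⊕ δ₁) ⊕ (γ₂ ⊕ δ₂)) F,
          (sw F γ₁ γ₂ δ₁ δ₂).i * ((sw F γ₁ γ₂ δ₁ δ₂).m * M) = M := by
        intro M
        rw [← Matrix.mul_assoc, (sw F γ₁ γ₂ δ₁ δ₂).im, Matrix.one_mul]
      simp only [Matrix.mul_assoc, hs]
    rw [e, BU_comp_left _ (by simpa using h3.symm) h.2]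

theorem sum_Rel (G : MIso F (α ⊕ β) (γ ⊕ δ))
    (h1 : Fintype.card γ₁ + Fintype.card γ₂ = Fintype.card γ)
    (h3 : Fintype.card γ₁ + Fintype.card δ₁ = Fintype.card α) :
    ∑ Q : MIso F ((γ₁ ⊕ γ₂) ⊕ (δ₁ ⊕ δ₂)) (γ ⊕ δ), ind (Rel G Q) =
      SS F γ₁ γ₂ δ₁ δ₂ * ind (∃ Q : MIso F ((γ₁ ⊕ γ₂) ⊕ (δ₁ ⊕ δ₂)) (γ ⊕ δ), Rel G Q) := by
  by_cases hQ : ∃ Q : MIso F ((γ₁ ⊕ γ₂) ⊕ (δ₁ ⊕ δ₂)) (γ ⊕ δ), Rel G Q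
  · rw [ind_true hQ, mul_one, ← sum_S]
    obtain ⟨Q₀, h⟩ := hQ
    rw [← Equiv.sum_comp (MIso.symmE.trans (MIso.compR Q₀))]
    apply Finset.sum_congr rfl
    intro S _
    rw [← ind_and]
    exact ind_congr (Rel_iff h1 h3 h S)
  · rw [ind_false hQ, mul_zero]
    apply Finset.sum_eq_zero
    intro Q _
    exact ind_false (fun h => hQ ⟨Q, h⟩)

/-- the summand in induction -/
noncomputable def Psi (g : Matrix α α F → ℂ) (h : Matrix β β F → ℂ)
    (w : Matrix (α ⊕ β) (α ⊕ β) F) : ℂ :=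
  ind (w.toBlocks₂₁ = 0) * (g w.toBlocks₁₁ * h w.toBlocks₂₂)

theorem sum_G_Rel {g : Matrix α α F → ℂ} {h : Matrix β β F → ℂ} (hg : Inv g) (hh : Inv h)
    (h3 : Fintype.card γ₁ + Fintype.card δ₁ = Fintype.card α)
    (h4 : Fintype.card γ₂ + Fintype.card δ₂ = Fintype.card β)
    (Q : MIso F ((γ₁ ⊕ γ₂) ⊕ (δ₁ ⊕ δ₂)) (γ ⊕ δ)) (z : Matrix (γ ⊕ δ) (γ ⊕ δ) F) :
    ∑ G : MIso F (α ⊕ β) (γ ⊕ δ), ind (Rel G Q) * Psi g h (G.conj z) =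
      PP F α β * (ind (BU Q) * Psi (TT (γ₁ ⊕ δ₁) g) (TT (γ₂ ⊕ δ₂) h)
        ((sw F γ₁ γ₂ δ₁ δ₂).conj (Q.conj z))) := by
  have h3' : Fintype.card α = Fintype.card (γ₁ ⊕ δ₁) := by simpa using h3.symm
  have h4' : Fintype.card β = Fintype.card (γ₂ ⊕ δ₂) := by simpa using h4.symm
  rw [← Equiv.sum_comp (MIso.compR (α := α ⊕ β) ((sw F γ₁ γ₂ δ₁ δ₂).comp Q))]
  rw [← sum_BU_one h3' h4', Finset.sum_mul]
  apply Finset.sum_congr rfl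
  intro P _
  have e : Rel (MIso.compR (α := α ⊕ β) ((sw F γ₁ γ₂ δ₁ δ₂).comp Q) P) Q ↔ (BU P ∧ BU Q) := by
    unfold Rel
    have : (MIso.compR (α := α ⊕ β) ((sw F γ₁ γ₂ δ₁ δ₂).comp Q) P).comp
        ((sw F γ₁ γ₂ δ₁ δ₂).comp Q).symm = P := by
      change (P.comp _).comp _ = P
      rw [MIso.comp_assoc, MIso.comp_symm, MIso.comp_one]
    rw [this, and_comm]
  rw [ind_congr e, ind_and]
  have e2 : (MIso.compR (α := α ⊕ β) ((sw F γ₁ γ₂ δ₁ δ₂).comp Q) P).conj z =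
      P.conj ((sw F γ₁ γ₂ δ₁ δ₂).conj (Q.conj z)) := by
    rw [← MIso.comp_conj, ← MIso.comp_conj, MIso.comp_assoc]; rfl
  rw [e2, mul_assoc]
  by_cases hP : BU P
  · obtain ⟨a, b, v, rfl⟩ := MIso.exists_but P h3' hP
    unfold Psi
    rw [but_ind a b v _ (fun x y => g x * h y), TT_eq hg a, TT_eq hh b]
  · rw [ind_false hP]; simp

end Mackey

section Mackey2

variable {α β γ δ ι κ κ' : Type} [Fintype α] [DecidableEq α] [Fintype β] [DecidableEq β]
  [Fintype γ] [DecidableEq γ] [Fintype δ] [DecidableEq δ] [Fintype ι] [DecidableEq ι]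
  [Fintype κ] [DecidableEq κ] [Fintype κ'] [DecidableEq κ']

theorem sum_Q (hc : Fintype.card κ = Fintype.card γ)
    (Φ : Matrix (κ ⊕ κ') (κ ⊕ κ') F → ℂ) (x : Matrix γ γ F) (y : Matrix δ δ F) :
    ∑ u : Matrix γ δ F, ∑ Q : MIso F (κ ⊕ κ') (γ ⊕ δ), ind (BU Q) * Φ (Q.conj (fromBlocks x u 0 y)) =
      qq F ^ (Fintype.card γ * Fintype.card δ) * ∑ a : MIso F κ γ, ∑ b : MIso F κ' δ,
        ∑ u : Matrix κ κ' F, Φ (fromBlocks (a.conj x) u 0 (b.conj y)) := by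
  have h := fun u : Matrix γ δ F => sum_but (F := F) (β := κ') (δ := δ) hc
    (fun Q => Φ (Q.conj (fromBlocks x u 0 y)))
  unfold BU
  simp_rw [h, MIso.but_conj]
  rw [Finset.sum_comm, Finset.mul_sum]
  apply Finset.sum_congr rfl
  intro a _
  rw [Finset.sum_comm, Finset.mul_sum]
  apply Finset.sum_congr rfl
  intro b _
  rw [Finset.sum_comm, ← hc, ← card_Mat (F := F) (α := κ) (β := δ), ← nsmul_eq_mul,
    ← Finset.card_univ, ← Finset.sum_const]
  apply Finset.sum_congr rfl
  intro v _
  let e : Matrix γ δ F ≃ Matrix κ κ' F :=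
    ⟨fun u => a.m * u * b.i + (v * y * b.i - a.m * x * (a.i * v * b.i)),
     fun u => a.i * (u - (v * y * b.i - a.m * x * (a.i * v * b.i))) * b.m, fun u => by
      dsimp only
      rw [add_sub_cancel_right]
      calc a.i * (a.m * u * b.i) * b.m = (a.i * a.m) * u * (b.i * b.m) := by
            simp only [Matrix.mul_assoc]
        _ = u := by rw [a.im, b.im, Matrix.one_mul, Matrix.mul_one], fun u => by
      dsimp only
      rw [← eq_sub_iff_add_eq]
      generalize u - (v * y * b.i - a.m * x * (a.i * v * b.i)) = w
      calc a.m * (a.i * w * b.m) * b.i = (a.m * a.i) * w * (b.m * b.i) := by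
            simp only [Matrix.mul_assoc]
        _ = w := by rw [a.mi, b.mi, Matrix.one_mul, Matrix.mul_one]⟩
  rw [← Equiv.sum_comp e]
  rfl

variable {γ₁ γ₂ δ₁ δ₂ : Type} [Fintype γ₁] [DecidableEq γ₁] [Fintype γ₂] [DecidableEq γ₂]
  [Fintype δ₁] [DecidableEq δ₁] [Fintype δ₂] [DecidableEq δ₂]

theorem sum_Psi_sw (g : Matrix α α F → ℂ) (h : Matrix β β F → ℂ)
    (x : Matrix (γ₁ ⊕ γ₂) (γ₁ ⊕ γ₂) F) (y : Matrix (δ₁ ⊕ δ₂) (δ₁ ⊕ δ₂) F) :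
    ∑ u : Matrix (γ₁ ⊕ γ₂) (δ₁ ⊕ δ₂) F, Psi (TT (γ₁ ⊕ δ₁) g) (TT (γ₂ ⊕ δ₂) h)
      ((sw F γ₁ γ₂ δ₁ δ₂).conj (fromBlocks x u 0 y)) =
    (qq F ^ (Fintype.card γ₁ * Fintype.card δ₁) *
    (qq F ^ (Fintype.card γ₁ * Fintype.card δ₂) * qq F ^ (Fintype.card γ₂ * Fintype.card δ₂))) *
    (ind (x.toBlocks₂₁ = 0) * (ind (y.toBlocks₂₁ = 0) *
      (Res γ₁ δ₁ g x.toBlocks₁₁ y.toBlocks₁₁ * Res γ₂ δ₂ h x.toBlocks₂₂ y.toBlocks₂₂))) := by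
  rw [sum_blocks]
  simp only [sw_conj_blocks, Psi, toBlocks_fromBlocks₁₁, toBlocks_fromBlocks₂₁,
    toBlocks_fromBlocks₂₂, fromBlocks_zero_iff, ind_and]
  have e : ∀ (a : Matrix γ₁ δ₁ F) (c : Matrix γ₂ δ₁ F) (d : Matrix γ₂ δ₂ F),
      ind (x.toBlocks₂₁ = 0) * (ind (c = 0) * (ind True * ind (y.toBlocks₂₁ = 0))) *
        (TT (γ₁ ⊕ δ₁) g (fromBlocks x.toBlocks₁₁ a 0 y.toBlocks₁₁) *
          TT (γ₂ ⊕ δ₂) h (fromBlocks x.toBlocks₂₂ d 0 y.toBlocks₂₂)) =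
      TT (γ₁ ⊕ δ₁) g (fromBlocks x.toBlocks₁₁ a 0 y.toBlocks₁₁) * (ind (c = 0) * 
        ((ind (x.toBlocks₂₁ = 0) * ind (y.toBlocks₂₁ = 0)) * 
          TT (γ₂ ⊕ δ₂) h (fromBlocks x.toBlocks₂₂ d 0 y.toBlocks₂₂))) := by
    intros; rw [ind_true (p := True) trivial]; ring
  simp_rw [e, ← Finset.mul_sum, ← Finset.sum_mul]
  have h1 := sum_ind_eq_zero (F := F) (α := γ₂) (β := δ₁) (fun _ => 1)
  simp only [mul_one] at h1
  rw [h1]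
  simp only [Finset.sum_const, nsmul_eq_mul, Finset.card_univ, card_Mat]
  unfold Res
  have := qq_ne (F := F)
  field_simp

theorem mackey_term {g : Matrix α α F → ℂ} {h : Matrix β β F → ℂ} (hg : Inv g) (hh : Inv h)
    (h1 : Fintype.card γ₁ + Fintype.card γ₂ = Fintype.card γ)
    (h3 : Fintype.card γ₁ + Fintype.card δ₁ = Fintype.card α)
    (h4 : Fintype.card γ₂ + Fintype.card δ₂ = Fintype.card β)
    (x : Matrix γ γ F) (y : Matrix δ δ F) :
    ∑ u : Matrix γ δ F, ∑ G : MIso F (α ⊕ β) (γ ⊕ δ),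
      ind (∃ Q : MIso F ((γ₁ ⊕ γ₂) ⊕ (δ₁ ⊕ δ₂)) (γ ⊕ δ), Rel G Q) *
        Psi g h (G.conj (fromBlocks x u 0 y)) =
    PP F α β * qq F ^ (Fintype.card γ * Fintype.card δ) *
      Ind γ₁ γ₂ γ (fun x1 x2 => Ind δ₁ δ₂ δ (fun y1 y2 =>
        Res γ₁ δ₁ g x1 y1 * Res γ₂ δ₂ h x2 y2) y) x := by
  have hS := SS_ne (F := F) (γ₁ := γ₁) (γ₂ := γ₂) (δ₁ := δ₁) (δ₂ := δ₂)
  have e1 : ∀ G : MIso F (α ⊕ β) (γ ⊕ δ), 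
      ind (∃ Q : MIso F ((γ₁ ⊕ γ₂) ⊕ (δ₁ ⊕ δ₂)) (γ ⊕ δ), Rel G Q) =
      (SS F γ₁ γ₂ δ₁ δ₂)⁻¹ * ∑ Q : MIso F ((γ₁ ⊕ γ₂) ⊕ (δ₁ ⊕ δ₂)) (γ ⊕ δ), ind (Rel G Q) := by
    intro G
    rw [sum_Rel G h1 h3]
    field_simp
  simp_rw [e1, mul_assoc, ← Finset.mul_sum, Finset.sum_mul]
  have e2 : ∀ u : Matrix γ δ F, ∑ G : MIso F (α ⊕ β) (γ ⊕ δ),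
      ∑ Q : MIso F ((γ₁ ⊕ γ₂) ⊕ (δ₁ ⊕ δ₂)) (γ ⊕ δ), ind (Rel G Q) *
        Psi g h (G.conj (fromBlocks x u 0 y)) = PP F α β * 
      ∑ Q : MIso F ((γ₁ ⊕ γ₂) ⊕ (δ₁ ⊕ δ₂)) (γ ⊕ δ),
      (ind (BU Q) * Psi (TT (γ₁ ⊕ δ₁) g) (TT (γ₂ ⊕ δ₂) h)
        ((sw F γ₁ γ₂ δ₁ δ₂).conj (Q.conj (fromBlocks x u 0 y)))) := by
    intro u
    rw [Finset.sum_comm, Finset.mul_sum]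
    exact Finset.sum_congr rfl (fun Q _ => sum_G_Rel hg hh h3 h4 Q _)
  simp_rw [e2, ← Finset.mul_sum]
  rw [sum_Q (by simpa using h1) (fun w => Psi (TT (γ₁ ⊕ δ₁) g) (TT (γ₂ ⊕ δ₂) h)
        ((sw F γ₁ γ₂ δ₁ δ₂).conj w))]
  simp_rw [sum_Psi_sw, ← Finset.mul_sum]
  unfold Ind SS
  change _ = _ * (_ * ((PP F γ₁ γ₂)⁻¹ * ∑ G : MIso F (γ₁ ⊕ γ₂) γ, _ * ((PP F δ₁ δ₂)⁻¹ * _)))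
  have e3 : ∀ a b : ℂ, a * ((PP F δ₁ δ₂)⁻¹ * b) = (PP F δ₁ δ₂)⁻¹ * (a * b) := by intros; ring
  simp_rw [e3, ← Finset.mul_sum]
  have := qq_ne (F := F)
  have := PP_ne (F := F) (α := γ₁) (β := γ₂)
  have := PP_ne (F := F) (α := δ₁) (β := δ₂)
  field_simp

end Mackey2

section Mackey3

variable {α β γ δ ι κ κ' : Type} [Fintype α] [DecidableEq α] [Fintype β] [DecidableEq β]
  [Fintype γ] [DecidableEq γ] [Fintype δ] [DecidableEq δ] [Fintype ι] [DecidableEq ι]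
  [Fintype κ] [DecidableEq κ] [Fintype κ'] [DecidableEq κ']
variable {γ₁ γ₂ δ₁ δ₂ : Type} [Fintype γ₁] [DecidableEq γ₁] [Fintype γ₂] [DecidableEq γ₂]
  [Fintype δ₁] [DecidableEq δ₁] [Fintype δ₂] [DecidableEq δ₂]

theorem BU_mulVec (P : MIso F (α ⊕ β) (γ ⊕ δ)) (hc : Fintype.card α = Fintype.card γ)
    (hP : BU P) (v : γ ⊕ δ → F) :
    ((P.m *ᵥ v) ∘ Sum.inr = 0 ↔ v ∘ Sum.inr = 0) := by
  obtain ⟨g, h, w, rfl⟩ := MIso.exists_but P hc hP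
  have e : ((MIso.but g h w).m *ᵥ v) ∘ Sum.inr = h.m *ᵥ (v ∘ Sum.inr) := by
    simp only [MIso.but]
    rw [fromBlocks_mulVec]
    simp
  rw [e]
  constructor
  · intro h0
    calc v ∘ Sum.inr = h.i *ᵥ (h.m *ᵥ (v ∘ Sum.inr)) := by
          rw [Matrix.mulVec_mulVec, h.im, Matrix.one_mulVec]
      _ = 0 := by rw [h0, Matrix.mulVec_zero]
  · intro h0; rw [h0, Matrix.mulVec_zero]

theorem ofEquiv_mulVec (e : α ≃ β) (v : β → F) : (MIso.ofEquiv F e).m *ᵥ v = v ∘ e := by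
  ext a
  simp [MIso.ofEquiv, Matrix.mulVec, dotProduct, Matrix.one_apply]

/-- The size of the intersection determines the type. -/
theorem Rel_card {G : MIso F (α ⊕ β) (γ ⊕ δ)} {Q : MIso F ((γ₁ ⊕ γ₂) ⊕ (δ₁ ⊕ δ₂)) (γ ⊕ δ)}
    (h1 : Fintype.card γ₁ + Fintype.card γ₂ = Fintype.card γ)
    (h3 : Fintype.card γ₁ + Fintype.card δ₁ = Fintype.card α) (h : Rel G Q) :
    Nat.card {v : γ ⊕ δ → F // v ∘ Sum.inr = 0 ∧ (G.m *ᵥ v) ∘ Sum.inr = 0} =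
      Fintype.card F ^ Fintype.card γ₁ := by
  rw [← Fintype.card_fun, ← Nat.card_eq_fintype_card]
  have hGv : ∀ v : γ ⊕ δ → F, (G.m *ᵥ v) ∘ Sum.inr = 0 ↔
      ((sw F γ₁ γ₂ δ₁ δ₂).m *ᵥ (Q.m *ᵥ v)) ∘ Sum.inr = 0 := by
    intro v
    rw [← BU_mulVec _ (by simpa using h3.symm) h.2]
    have : (G.comp ((sw F γ₁ γ₂ δ₁ δ₂).comp Q).symm).m *ᵥ
        ((sw F γ₁ γ₂ δ₁ δ₂).m *ᵥ (Q.m *ᵥ v)) = G.m *ᵥ v := by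
      rw [Matrix.mulVec_mulVec, Matrix.mulVec_mulVec]
      congr 1
      have := congrArg MIso.m (MIso.comp_assoc G ((sw F γ₁ γ₂ δ₁ δ₂).comp Q).symm
        ((sw F γ₁ γ₂ δ₁ δ₂).comp Q))
      rw [MIso.symm_comp, MIso.comp_one] at this
      rw [← this]
      simp only [MIso.comp, Matrix.mul_assoc]
    rw [this]
  have hUv : ∀ v : γ ⊕ δ → F, v ∘ Sum.inr = 0 ↔ (Q.m *ᵥ v) ∘ Sum.inr = 0 :=
    fun v => (BU_mulVec Q (by simpa using h1) h.1 v).symm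
  refine Nat.card_congr ⟨fun v a => (Q.m *ᵥ v.1) (Sum.inl (Sum.inl a)),
    fun w => ⟨Q.i *ᵥ (Sum.elim (Sum.elim w 0) 0), ?_, ?_⟩, ?_, ?_⟩
  · rw [hUv, Matrix.mulVec_mulVec, Q.mi, Matrix.one_mulVec]; rfl
  · rw [hGv, Matrix.mulVec_mulVec, Matrix.mulVec_mulVec, Matrix.mul_assoc, Q.mi, Matrix.mul_one]
    unfold sw
    rw [ofEquiv_mulVec]
    ext a
    rcases a with a | a <;> rfl
  · rintro ⟨v, hv1, hv2⟩
    apply Subtype.ext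
    dsimp only
    rw [hUv] at hv1
    rw [hGv] at hv2
    unfold sw at hv2
    rw [ofEquiv_mulVec] at hv2
    have : Sum.elim (Sum.elim (fun a => (Q.m *ᵥ v) (Sum.inl (Sum.inl a))) 0) 0 = Q.m *ᵥ v := by
      ext a
      rcases a with (a | a) | a
      · rfl
      · exact (congrFun hv2 (Sum.inl a)).symm
      · exact (congrFun hv1 a).symm
    rw [this, Matrix.mulVec_mulVec, Q.im, Matrix.one_mulVec]
  · intro w
    dsimp only
    rw [Matrix.mulVec_mulVec, Q.mi, Matrix.one_mulVec]
    rfl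

theorem exists_rel_compl {V : Type} [AddCommGroup V] [Module F V] (A U : Submodule F V) (h : A ≤ U) :
    ∃ U' : Submodule F V, A ⊔ U' = U ∧ A ⊓ U' = ⊥ := by
  obtain ⟨C, hC⟩ := Submodule.exists_isCompl A
  refine ⟨C ⊓ U, ?_, ?_⟩
  · rw [← sup_inf_assoc_of_le C h, hC.sup_eq_top, top_inf_eq]
  · rw [← inf_assoc, hC.inf_eq_bot, bot_inf_eq]

theorem finrank_ker_surj {V : Type} [AddCommGroup V] [Module F V] [FiniteDimensional F V]
    (f : V →ₗ[F] (κ → F)) (hf : Function.Surjective f) :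
    Module.finrank F (LinearMap.ker f) + Fintype.card κ = Module.finrank F V := by
  have := f.finrank_range_add_finrank_ker
  rw [LinearMap.range_eq_top.2 hf, finrank_top, Module.finrank_fintype_fun_eq_card] at this
  omega

theorem span_range_finBasis {V : Type} [AddCommGroup V] [Module F V] [FiniteDimensional F V]
    (A : Submodule F V) :
    Submodule.span F (Set.range (fun i => (Module.finBasis F A i : V))) = A := by
  have h := (Module.finBasis F A).span_eq
  have := congrArg (Submodule.map A.subtype) h
  rw [Submodule.map_span, Submodule.map_top, Submodule.range_subtype, ← Set.range_comp] at this
  exact this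

theorem exists_adapted {V : Type} [AddCommGroup V] [Module F V] [FiniteDimensional F V]
    (U W : Submodule F V) : ∃ k1 k2 l1 l2 : ℕ,
    ∃ b : Module.Basis ((Fin k1 ⊕ Fin k2) ⊕ (Fin l1 ⊕ Fin l2)) F V,
      k1 + k2 = Module.finrank F U ∧ k1 + l1 = Module.finrank F W ∧
      (∀ j, b (Sum.inl j) ∈ U) ∧ (∀ j, b (Sum.inl (Sum.inl j)) ∈ W) ∧
      (∀ j, b (Sum.inr (Sum.inl j)) ∈ W) := by
  obtain ⟨U', hU1, hU2⟩ := exists_rel_compl (U ⊓ W) U inf_le_left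
  obtain ⟨W', hW1, hW2⟩ := exists_rel_compl (U ⊓ W) W inf_le_right
  obtain ⟨Z, hZ⟩ := Submodule.exists_isCompl (U ⊔ W)
  have d1 := Submodule.finrank_sup_add_finrank_inf_eq (U ⊓ W) U'
  have d2 := Submodule.finrank_sup_add_finrank_inf_eq (U ⊓ W) W'
  have d3 := Submodule.finrank_sup_add_finrank_inf_eq U W
  have d4 := Submodule.finrank_sup_add_finrank_inf_eq (U ⊔ W) Z
  rw [hU1, hU2, finrank_bot] at d1
  rw [hW1, hW2, finrank_bot] at d2
  rw [hZ.sup_eq_top, hZ.inf_eq_bot, finrank_bot, finrank_top] at d4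
  let v : (Fin (Module.finrank F ↥(U ⊓ W)) ⊕ Fin (Module.finrank F U')) ⊕
      (Fin (Module.finrank F W') ⊕ Fin (Module.finrank F Z)) → V :=
    Sum.elim (Sum.elim (fun i => (Module.finBasis F ↥(U ⊓ W) i : V)) (fun i => (Module.finBasis F U' i : V)))
      (Sum.elim (fun i => (Module.finBasis F W' i : V)) (fun i => (Module.finBasis F Z i : V)))
  have hspan : ⊤ ≤ Submodule.span F (Set.range v) := by
    simp only [v, Set.Sum.elim_range, Submodule.span_union, span_range_finBasis]
    rw [hU1]
    rw [← hZ.sup_eq_top]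
    apply sup_le
    · apply sup_le
      · exact le_sup_left
      · rw [← hW1]
        apply sup_le
        · exact inf_le_left.trans le_sup_left
        · exact le_sup_left.trans le_sup_right
    · exact le_sup_right.trans le_sup_right
  have hcard : Fintype.card ((Fin (Module.finrank F ↥(U ⊓ W)) ⊕ Fin (Module.finrank F U')) ⊕
      (Fin (Module.finrank F W') ⊕ Fin (Module.finrank F Z))) = Module.finrank F V := by
    simp only [Fintype.card_sum, Fintype.card_fin]
    omega
  have hU' : U' ≤ U := by rw [← hU1]; exact le_sup_right
  have hW' : W' ≤ W := by rw [← hW1]; exact le_sup_right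
  refine ⟨_, _, _, _, basisOfTopLeSpanOfCardEqFinrank v hspan hcard, by omega, by omega, ?_, ?_, ?_⟩
  · intro j
    rw [coe_basisOfTopLeSpanOfCardEqFinrank]
    rcases j with j | j
    · exact (Module.finBasis F ↥(U ⊓ W) j).2.1
    · exact hU' (Module.finBasis F U' j).2
  · intro j
    rw [coe_basisOfTopLeSpanOfCardEqFinrank]
    exact (Module.finBasis F ↥(U ⊓ W) j).2.2
  · intro j
    rw [coe_basisOfTopLeSpanOfCardEqFinrank]
    exact hW' (Module.finBasis F W' j).2

theorem exists_Rel (G : MIso F (α ⊕ β) (γ ⊕ δ)) : ∃ k1 k2 l1 l2 : ℕ,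
    k1 + k2 = Fintype.card γ ∧ l1 + l2 = Fintype.card δ ∧ k1 + l1 = Fintype.card α ∧
    k2 + l2 = Fintype.card β ∧
    ∃ Q : MIso F ((Fin k1 ⊕ Fin k2) ⊕ (Fin l1 ⊕ Fin l2)) (γ ⊕ δ), Rel G Q := by
  let fU : (γ ⊕ δ → F) →ₗ[F] (δ → F) := LinearMap.funLeft F F Sum.inr
  let fW : (γ ⊕ δ → F) →ₗ[F] (β → F) := (LinearMap.funLeft F F Sum.inr).comp G.m.mulVecLin
  have hfU : Function.Surjective fU := LinearMap.funLeft_surjective_of_injective F F _ Sum.inr_injective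
  have hfW : Function.Surjective fW := by
    intro w
    refine ⟨G.i *ᵥ Sum.elim 0 w, ?_⟩
    simp only [fW, LinearMap.comp_apply, Matrix.mulVecLin_apply, Matrix.mulVec_mulVec, G.mi,
      Matrix.one_mulVec]
    rfl
  have dU := finrank_ker_surj fU hfU
  have dW := finrank_ker_surj fW hfW
  have hcc := G.card_eq
  rw [Module.finrank_fintype_fun_eq_card] at dU dW
  simp only [Fintype.card_sum] at dU dW hcc
  obtain ⟨k1, k2, l1, l2, b, hk, hl, bU, bW, bW'⟩ := exists_adapted (LinearMap.ker fU) (LinearMap.ker fW)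
  have htot := Module.finrank_eq_card_basis b
  rw [Module.finrank_fintype_fun_eq_card] at htot
  simp only [Fintype.card_sum, Fintype.card_fin] at htot
  let R : MIso F (γ ⊕ δ) ((Fin k1 ⊕ Fin k2) ⊕ (Fin l1 ⊕ Fin l2)) :=
    ⟨(Pi.basisFun F (γ ⊕ δ)).toMatrix b, b.toMatrix (Pi.basisFun F (γ ⊕ δ)),
      Module.Basis.toMatrix_mul_toMatrix_flip _ _, Module.Basis.toMatrix_mul_toMatrix_flip _ _⟩
  have hR : ∀ i j, R.m i j = b j i := by
    intro i j
    simp [R, Module.Basis.toMatrix_apply]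
  have hRU : BU R := by
    ext i j
    exact (hR _ _).trans (congrFun (LinearMap.mem_ker.1 (bU j)) i)
  refine ⟨k1, k2, l1, l2, by omega, by omega, by omega, by omega, R.symm,
    BU_symm R (by simp; omega) hRU, ?_⟩
  have hGR : (G.comp ((sw F (Fin k1) (Fin k2) (Fin l1) (Fin l2)).comp R.symm).symm).m =
      fun i j => (G.m *ᵥ (b (Equiv.sumSumSumComm _ _ _ _ j))) i := by
    ext i j
    have : (G.comp ((sw F (Fin k1) (Fin k2) (Fin l1) (Fin l2)).comp R.symm).symm).m =
      (G.m * R.m) * (sw F (Fin k1) (Fin k2) (Fin l1) (Fin l2)).i := by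
      simp only [MIso.comp, MIso.symm, Matrix.mul_assoc]
    rw [this]
    simp only [sw, MIso.ofEquiv]
    rw [Matrix.mul_apply]
    simp [Matrix.one_apply, Matrix.mul_apply, Matrix.mulVec, dotProduct, hR]
  unfold BU
  rw [hGR]
  ext i j
  rcases j with j | j
  · exact (congrFun (LinearMap.mem_ker.1 (bW j)) i)
  · exact (congrFun (LinearMap.mem_ker.1 (bW' j)) i)

end Mackey3

section Mackey4

variable {α β γ δ ι κ κ' : Type} [Fintype α] [DecidableEq α] [Fintype β] [DecidableEq β]
  [Fintype γ] [DecidableEq γ] [Fintype δ] [DecidableEq δ] [Fintype ι] [DecidableEq ι]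
  [Fintype κ] [DecidableEq κ] [Fintype κ'] [DecidableEq κ']

theorem Ind_zero_fun (z : Matrix ι ι F) : Ind α β ι (fun _ _ => (0 : ℂ)) z = 0 := by
  simp [Ind]

theorem Ind_congr {p p' : Matrix α α F → Matrix β β F → ℂ} (h : ∀ x y, p x y = p' x y)
    (z : Matrix ι ι F) : Ind α β ι p z = Ind α β ι p' z := by
  have : p = p' := by funext x y; exact h x y
  rw [this]

/-- The admissible types. -/
def Good (a b c d : ℕ) (t : ℕ × ℕ × ℕ × ℕ) : Prop :=
  t.1 + t.2.1 = c ∧ t.2.2.1 + t.2.2.2 = d ∧ t.1 + t.2.2.1 = a ∧ t.2.1 + t.2.2.2 = b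

theorem sum_types (G : MIso F (α ⊕ β) (γ ⊕ δ)) (N : ℕ) (hN1 : Fintype.card γ < N)
    (hN2 : Fintype.card δ < N) :
    ∑ t ∈ Finset.range N ×ˢ Finset.range N ×ˢ Finset.range N ×ˢ Finset.range N,
      ind (Good (Fintype.card α) (Fintype.card β) (Fintype.card γ) (Fintype.card δ) t) *
      ind (∃ Q : MIso F ((Fin t.1 ⊕ Fin t.2.1) ⊕ (Fin t.2.2.1 ⊕ Fin t.2.2.2)) (γ ⊕ δ), Rel G Q) = 1 := by
  obtain ⟨k1, k2, l1, l2, e1, e2, e3, e4, Q, hQ⟩ := exists_Rel G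
  rw [Finset.sum_eq_single (k1, k2, l1, l2)]
  · rw [ind_true ⟨e1, e2, e3, e4⟩, ind_true ⟨Q, hQ⟩, one_mul]
  · rintro ⟨k1', k2', l1', l2'⟩ _ hne
    by_contra hcon
    have hg : Good (Fintype.card α) (Fintype.card β) (Fintype.card γ) (Fintype.card δ)
      (k1', k2', l1', l2') := by
      by_contra h; exact hcon (by rw [ind_false h, zero_mul])
    have hq : ∃ Q : MIso F ((Fin k1' ⊕ Fin k2') ⊕ (Fin l1' ⊕ Fin l2')) (γ ⊕ δ), Rel G Q := by
      by_contra h; exact hcon (by rw [ind_false h, mul_zero])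
    obtain ⟨Q', hQ'⟩ := hq
    obtain ⟨f1, f2, f3, f4⟩ := hg
    simp only at f1 f2 f3 f4
    have c1 := Rel_card (by simpa using e1) (by simpa using e3) hQ
    have c2 := Rel_card (by simpa using f1) (by simpa using f3) hQ'
    rw [c1] at c2
    simp only [Fintype.card_fin] at c2
    have := Nat.pow_right_injective (Fintype.one_lt_card (α := F)) c2
    apply hne
    have : k2 = k2' := by omega
    have : l1 = l1' := by omega
    have : l2 = l2' := by omega
    simp_all
  · intro h
    exfalso
    apply h
    simp only [Finset.mem_product, Finset.mem_range]
    omega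

theorem mackey {g : Matrix α α F → ℂ} {h : Matrix β β F → ℂ} (hg : Inv g) (hh : Inv h) (N : ℕ)
    (hN1 : Fintype.card γ < N) (hN2 : Fintype.card δ < N) (x : Matrix γ γ F) (y : Matrix δ δ F) :
    (qq F ^ (Fintype.card γ * Fintype.card δ))⁻¹ *
      ∑ u : Matrix γ δ F, Ind α β (γ ⊕ δ) (fun a b => g a * h b) (fromBlocks x u 0 y) =
    ∑ t ∈ Finset.range N ×ˢ Finset.range N ×ˢ Finset.range N ×ˢ Finset.range N,
      Ind (Fin t.1) (Fin t.2.1) γ (fun x1 x2 => Ind (Fin t.2.2.1) (Fin t.2.2.2) δ (fun y1 y2 =>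
        Res (Fin t.1) (Fin t.2.2.1) g x1 y1 * Res (Fin t.2.1) (Fin t.2.2.2) h x2 y2) y) x := by
  have hterm : ∀ t : ℕ × ℕ × ℕ × ℕ,
      Ind (Fin t.1) (Fin t.2.1) γ (fun x1 x2 => Ind (Fin t.2.2.1) (Fin t.2.2.2) δ (fun y1 y2 =>
        Res (Fin t.1) (Fin t.2.2.1) g x1 y1 * Res (Fin t.2.1) (Fin t.2.2.2) h x2 y2) y) x =
      (PP F α β * qq F ^ (Fintype.card γ * Fintype.card δ))⁻¹ *
      ∑ u : Matrix γ δ F, ∑ G : MIso F (α ⊕ β) (γ ⊕ δ),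
        (ind (Good (Fintype.card α) (Fintype.card β) (Fintype.card γ) (Fintype.card δ) t) *
        ind (∃ Q : MIso F ((Fin t.1 ⊕ Fin t.2.1) ⊕ (Fin t.2.2.1 ⊕ Fin t.2.2.2)) (γ ⊕ δ), Rel G Q)) *
        Psi g h (G.conj (fromBlocks x u 0 y)) := by
    intro t
    by_cases hG : Good (Fintype.card α) (Fintype.card β) (Fintype.card γ) (Fintype.card δ) t
    · rw [ind_true hG]
      obtain ⟨f1, f2, f3, f4⟩ := hG
      simp only [one_mul]
      rw [mackey_term hg hh (by simpa using f1) (by simpa using f3) (by simpa using f4)]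
      have := qq_ne (F := F)
      have := PP_ne (F := F) (α := α) (β := β)
      field_simp
    · rw [ind_false hG]
      simp only [zero_mul, Finset.sum_const_zero, mul_zero]
      by_cases f1 : t.1 + t.2.1 = Fintype.card γ
      · by_cases f2 : t.2.2.1 + t.2.2.2 = Fintype.card δ
        · rw [← Ind_zero_fun (F := F) (α := Fin t.1) (β := Fin t.2.1) x]
          apply Ind_congr
          intro x1 x2
          rw [← Ind_zero_fun (F := F) (α := Fin t.2.2.1) (β := Fin t.2.2.2) y]
          apply Ind_congr
          intro y1 y2
          by_cases f3 : t.1 + t.2.2.1 = Fintype.card α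
          · by_cases f4 : t.2.1 + t.2.2.2 = Fintype.card β
            · exact absurd ⟨f1, f2, f3, f4⟩ hG
            · rw [Res_zero_of_card (ι := β) (by simpa using f4), mul_zero]
          · rw [Res_zero_of_card (ι := α) (by simpa using f3), zero_mul]
        · rw [← Ind_zero_fun (F := F) (α := Fin t.1) (β := Fin t.2.1) x]
          apply Ind_congr
          intro x1 x2
          exact Ind_zero_of_card (by simpa using f2) _ _
      · exact Ind_zero_of_card (by simpa using f1) _ _
  rw [Finset.sum_congr rfl (fun t _ => hterm t), ← Finset.mul_sum, Finset.sum_comm]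
  have e : ∀ u : Matrix γ δ F,
    ∑ t ∈ Finset.range N ×ˢ Finset.range N ×ˢ Finset.range N ×ˢ Finset.range N,
      ∑ G : MIso F (α ⊕ β) (γ ⊕ δ),
        (ind (Good (Fintype.card α) (Fintype.card β) (Fintype.card γ) (Fintype.card δ) t) *
        ind (∃ Q : MIso F ((Fin t.1 ⊕ Fin t.2.1) ⊕ (Fin t.2.2.1 ⊕ Fin t.2.2.2)) (γ ⊕ δ), Rel G Q)) *
        Psi g h (G.conj (fromBlocks x u 0 y)) =
      PP F α β * Ind α β (γ ⊕ δ) (fun a b => g a * h b) (fromBlocks x u 0 y) := by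
    intro u
    rw [Finset.sum_comm]
    simp_rw [← Finset.sum_mul, sum_types _ N hN1 hN2, one_mul]
    unfold Ind
    change _ = PP F α β * ((PP F α β)⁻¹ * _)
    rw [← mul_assoc, mul_inv_cancel₀ PP_ne, one_mul]
    rfl
  simp_rw [e, ← Finset.mul_sum]
  have := qq_ne (F := F)
  have := PP_ne (F := F) (α := α) (β := β)
  field_simp

theorem mackey_Res {g : Matrix α α F → ℂ} {h : Matrix β β F → ℂ} (hg : Inv g) (hh : Inv h) (N : ℕ)
    (hc : Fintype.card γ + Fintype.card δ = Fintype.card ι)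
    (hN1 : Fintype.card γ < N) (hN2 : Fintype.card δ < N) (x : Matrix γ γ F) (y : Matrix δ δ F) :
    Res γ δ (Ind α β ι (fun a b => g a * h b)) x y =
    ∑ k1 ∈ Finset.range N, ∑ k2 ∈ Finset.range N, ∑ l1 ∈ Finset.range N, ∑ l2 ∈ Finset.range N,
      Ind (Fin k1) (Fin k2) γ (fun x1 x2 => Ind (Fin l1) (Fin l2) δ (fun y1 y2 =>
        Res (Fin k1) (Fin l1) g x1 y1 * Res (Fin k2) (Fin l2) h x2 y2) y) x := by
  have := mackey hg hh N hN1 hN2 x y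
  simp only [Finset.sum_product] at this
  rw [← this]
  unfold Res
  congr 1
  apply Finset.sum_congr rfl
  intro u _
  rw [TT_Ind _ (by simpa using hc.symm)]

end Mackey4

section Primitives

variable {α β γ δ ι κ κ' : Type} [Fintype α] [DecidableEq α] [Fintype β] [DecidableEq β]
  [Fintype γ] [DecidableEq γ] [Fintype δ] [DecidableEq δ] [Fintype ι] [DecidableEq ι]
  [Fintype κ] [DecidableEq κ] [Fintype κ'] [DecidableEq κ']

/-- Primitive (pre-cuspidal) functions. -/
def Prim (h : Matrix β β F → ℂ) : Prop :=
  ∀ k l : ℕ, 1 ≤ k → 1 ≤ l → ∀ (x : Matrix (Fin k) (Fin k) F) (y : Matrix (Fin l) (Fin l) F),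
    Res (Fin k) (Fin l) h x y = 0

theorem Ind_param_Inv {p : Matrix κ κ F → Matrix α α F → Matrix β β F → ℂ}
    (hp : ∀ a b, Inv (fun x => p x a b)) (z : Matrix ι ι F) :
    Inv (fun x => Ind α β ι (p x) z) := by
  intro G x
  apply Ind_congr
  intro a b
  exact hp a b G x

theorem sum_two (N b : ℕ) (hb : 1 ≤ b) (hbN : b < N) (f : ℕ → ℕ → ℂ)
    (h1 : ∀ k l, 1 ≤ k → 1 ≤ l → f k l = 0) (h2 : ∀ k l, k + l ≠ b → f k l = 0) :
    ∑ k ∈ Finset.range N, ∑ l ∈ Finset.range N, f k l = f 0 b + f b 0 := by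
  rw [← Finset.sum_product', Finset.sum_eq_add (0, b) (b, 0)]
  · simp; omega
  · rintro ⟨k, l⟩ _ ⟨hh1, hh2⟩
    by_cases hkl : k + l = b
    · apply h1
      · rcases Nat.eq_zero_or_pos k with rfl | hk
        · exfalso; apply hh1; simp at hkl; simp [hkl]
        · exact hk
      · rcases Nat.eq_zero_or_pos l with rfl | hl
        · exfalso; apply hh2; simp at hkl; simp [hkl]
        · exact hl
    · exact h2 k l hkl
  · intro h; exfalso; apply h; simp; omega
  · intro h; exfalso; apply h; simp; omega

theorem TT_congr {f f' : Matrix α α F → ℂ} (h : ∀ x, f x = f' x) (z : Matrix ι ι F) :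
    TT ι f z = TT ι f' z := by
  have : f = f' := funext h
  rw [this]

theorem sum_TT (N k : ℕ) (hk : k < N) (f : ∀ k1 : ℕ, Matrix (Fin k1) (Fin k1) F → ℂ)
    (hf : Inv (f k)) (x : Matrix (Fin k) (Fin k) F) :
    ∑ k1 ∈ Finset.range N, TT (Fin k) (f k1) x = f k x := by
  rw [Finset.sum_eq_single k]
  · exact TT_self hf x
  · intro k1 _ hne
    exact TT_zero _ (by simpa using hne) _
  · intro h; exact absurd (Finset.mem_range.2 hk) h

theorem mackey_prim {b k l : ℕ} {g : Matrix α α F → ℂ} {h : Matrix (Fin b) (Fin b) F → ℂ}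
    (hg : Inv g) (hh : Inv h) (hp : Prim h) (hb : 1 ≤ b) (N : ℕ)
    (hc : k + l = Fintype.card ι) (hk : k < N) (hl : l < N) (hbN : b < N)
    (x : Matrix (Fin k) (Fin k) F) (y : Matrix (Fin l) (Fin l) F) :
    Res (Fin k) (Fin l) (Ind α (Fin b) ι (fun a b => g a * h b)) x y =
    ∑ l1 ∈ Finset.range N, Ind (Fin l1) (Fin b) (Fin l)
        (fun y1 y2 => Res (Fin k) (Fin l1) g x y1 * h y2) y +
    ∑ k1 ∈ Finset.range N, Ind (Fin k1) (Fin b) (Fin k)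
        (fun x1 x2 => Res (Fin k1) (Fin l) g x1 y * h x2) x := by
  rw [mackey_Res hg hh N (by simpa using hc) (by simpa using hk) (by simpa using hl)]
  have e : ∀ k1 k2 : ℕ, ∑ l1 ∈ Finset.range N, ∑ l2 ∈ Finset.range N,
      Ind (Fin k1) (Fin k2) (Fin k) (fun x1 x2 => Ind (Fin l1) (Fin l2) (Fin l) (fun y1 y2 =>
        Res (Fin k1) (Fin l1) g x1 y1 * Res (Fin k2) (Fin l2) h x2 y2) y) x =
      ∑ l2 ∈ Finset.range N, ∑ l1 ∈ Finset.range N,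
      Ind (Fin k1) (Fin k2) (Fin k) (fun x1 x2 => Ind (Fin l1) (Fin l2) (Fin l) (fun y1 y2 =>
        Res (Fin k1) (Fin l1) g x1 y1 * Res (Fin k2) (Fin l2) h x2 y2) y) x :=
    fun k1 k2 => Finset.sum_comm
  simp_rw [e]
  have e2 : ∀ k1 : ℕ, ∑ k2 ∈ Finset.range N, ∑ l2 ∈ Finset.range N, ∑ l1 ∈ Finset.range N,
      Ind (Fin k1) (Fin k2) (Fin k) (fun x1 x2 => Ind (Fin l1) (Fin l2) (Fin l) (fun y1 y2 =>
        Res (Fin k1) (Fin l1) g x1 y1 * Res (Fin k2) (Fin l2) h x2 y2) y) x = 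
     ∑ l1 ∈ Finset.range N, TT (Fin k) (fun x1 => Ind (Fin l1) (Fin b) (Fin l)
        (fun y1 y2 => Res (Fin k1) (Fin l1) g x1 y1 * h y2) y) x +
      ∑ l1 ∈ Finset.range N,
      Ind (Fin k1) (Fin b) (Fin k) (fun x1 x2 => TT (Fin l) (fun y1 =>
        Res (Fin k1) (Fin l1) g x1 y1 * h x2) y) x := by
    intro k1
    have hz : ∀ k2 l2 : ℕ, (∀ x2 y2, Res (Fin k2) (Fin l2) h x2 y2 = 0) → 
      ∑ l1 ∈ Finset.range N,
      Ind (Fin k1) (Fin k2) (Fin k) (fun x1 x2 => Ind (Fin l1) (Fin l2) (Fin l) (fun y1 y2 =>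
        Res (Fin k1) (Fin l1) g x1 y1 * Res (Fin k2) (Fin l2) h x2 y2) y) x = 0 := by
      intro k2 l2 h0
      simp only [h0, mul_zero, Ind_zero_fun, Finset.sum_const_zero]
    rw [sum_two N b hb hbN _ (fun k2 l2 hk2 hl2 => hz k2 l2 (hp k2 l2 hk2 hl2))
      (fun k2 l2 hkl => hz k2 l2 (fun x2 y2 => Res_zero_of_card (by simpa using hkl) h x2 y2))]
    congr 1
    · apply Finset.sum_congr rfl
      intro l1 _
      rw [Ind_right_empty]
      simp only [Res_left_empty, TT_self hh]
    · apply Finset.sum_congr rfl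
      intro l1 _
      simp only [Ind_right_empty, Res_right_empty, TT_self hh]
  simp_rw [e2]
  rw [Finset.sum_add_distrib]
  congr 1
  · rw [Finset.sum_comm]
    apply Finset.sum_congr rfl
    intro l1 _
    rw [sum_TT N k hk (fun k1 x1 => Ind (Fin l1) (Fin b) (Fin l)
        (fun y1 y2 => Res (Fin k1) (Fin l1) g x1 y1 * h y2) y)]
    apply Ind_param_Inv
    intro a c G x
    exact congrArg (· * h c) (Res_Inv_left g a G x)
  · apply Finset.sum_congr rfl
    intro k1 _
    rw [Finset.sum_eq_single l]
    · apply Ind_congr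
      intro x1 x2
      rw [TT_self]
      intro G y
      dsimp only
      rw [Res_Inv_right g x1 G y]
    · intro l1 _ hne
      rw [← Ind_zero_fun (F := F) (α := Fin k1) (β := Fin b) x]
      apply Ind_congr
      intro x1 x2
      exact TT_zero _ (by simpa using hne) _
    · intro h; exact absurd (Finset.mem_range.2 hl) h

end Primitives

section Linear

variable {α β γ δ ι κ κ' : Type} [Fintype α] [DecidableEq α] [Fintype β] [DecidableEq β]
  [Fintype γ] [DecidableEq γ] [Fintype δ] [DecidableEq δ] [Fintype ι] [DecidableEq ι]
  [Fintype κ] [DecidableEq κ] [Fintype κ'] [DecidableEq κ']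

theorem TT_add (f f' : Matrix α α F → ℂ) (z : Matrix ι ι F) :
    TT ι (fun x => f x + f' x) z = TT ι f z + TT ι f' z := by
  unfold TT; rw [Finset.sum_add_distrib, mul_add]

theorem TT_mul (c : ℂ) (f : Matrix α α F → ℂ) (z : Matrix ι ι F) :
    TT ι (fun x => c * f x) z = c * TT ι f z := by
  unfold TT; rw [← Finset.mul_sum]; ring

theorem TT_star (f : Matrix α α F → ℂ) (z : Matrix ι ι F) :
    TT ι (fun x => (starRingEnd ℂ) (f x)) z = (starRingEnd ℂ) (TT ι f z) := by
  unfold TT NN; simp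

theorem Res_add (f f' : Matrix ι ι F → ℂ) (x : Matrix α α F) (y : Matrix β β F) :
    Res α β (fun z => f z + f' z) x y = Res α β f x y + Res α β f' x y := by
  unfold Res; simp_rw [TT_add]; rw [Finset.sum_add_distrib, mul_add]

theorem Res_mul (c : ℂ) (f : Matrix ι ι F → ℂ) (x : Matrix α α F) (y : Matrix β β F) :
    Res α β (fun z => c * f z) x y = c * Res α β f x y := by
  unfold Res; simp_rw [TT_mul]; rw [← Finset.mul_sum]; ring

theorem Res_star (f : Matrix ι ι F → ℂ) (x : Matrix α α F) (y : Matrix β β F) :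
    Res α β (fun z => (starRingEnd ℂ) (f z)) x y = (starRingEnd ℂ) (Res α β f x y) := by
  unfold Res; simp_rw [TT_star]; simp [qq]

theorem Res_sub (f f' : Matrix ι ι F → ℂ) (x : Matrix α α F) (y : Matrix β β F) :
    Res α β (fun z => f z - f' z) x y = Res α β f x y - Res α β f' x y := by
  have h : (fun z => f z - f' z) = fun z => f z + (-1) * f' z := by funext z; ring
  rw [h, Res_add, Res_mul]; ring

theorem Ind_add (p p' : Matrix α α F → Matrix β β F → ℂ) (z : Matrix ι ι F) :
    Ind α β ι (fun x y => p x y + p' x y) z = Ind α β ι p z + Ind α β ι p' z := by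
  unfold Ind; simp_rw [mul_add]; rw [Finset.sum_add_distrib, mul_add]

theorem Ind_mul (c : ℂ) (p : Matrix α α F → Matrix β β F → ℂ) (z : Matrix ι ι F) :
    Ind α β ι (fun x y => c * p x y) z = c * Ind α β ι p z := by
  unfold Ind
  rw [Finset.mul_sum, Finset.mul_sum, Finset.mul_sum]
  apply Finset.sum_congr rfl
  intro G _
  ring

theorem Ind_sum {S : Type} (s : Finset S) (p : S → Matrix α α F → Matrix β β F → ℂ)
    (z : Matrix ι ι F) :
    Ind α β ι (fun x y => ∑ i ∈ s, p i x y) z = ∑ i ∈ s, Ind α β ι (p i) z := by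
  induction s using Finset.induction_on with
  | empty => simp [Ind_zero_fun]
  | insert a s ha ih =>
    simp_rw [Finset.sum_insert ha]
    rw [Ind_add, ih]

theorem Inv_sub {f f' : Matrix α α F → ℂ} (h : Inv f) (h' : Inv f') : Inv (fun x => f x - f' x) :=
  fun G x => by dsimp only; rw [h G x, h' G x]

theorem Inv_star {f : Matrix α α F → ℂ} (h : Inv f) : Inv (fun x => (starRingEnd ℂ) (f x)) :=
  fun G x => by dsimp only; rw [h G x]

theorem Inv_add {f f' : Matrix α α F → ℂ} (h : Inv f) (h' : Inv f') : Inv (fun x => f x + f' x) :=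
  fun G x => by dsimp only; rw [h G x, h' G x]

theorem Inv_mul (c : ℂ) {f : Matrix α α F → ℂ} (h : Inv f) : Inv (fun x => c * f x) :=
  fun G x => by dsimp only; rw [h G x]

theorem eq_zero_of_sum_star (c : Matrix α α F → ℂ)
    (h : ∑ z, c z * (starRingEnd ℂ) (c z) = 0) (z : Matrix α α F) : c z = 0 := by
  simp_rw [Complex.mul_conj] at h
  have h2 : ∑ z, Complex.normSq (c z) = 0 := by exact_mod_cast h
  rw [Finset.sum_eq_zero_iff_of_nonneg (fun _ _ => Complex.normSq_nonneg _)] at h2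
  exact Complex.normSq_eq_zero.1 (h2 z (Finset.mem_univ _))

theorem Res_prim_prim {b b' k l : ℕ} {h : Matrix (Fin b) (Fin b) F → ℂ}
    {h' : Matrix (Fin b') (Fin b') F → ℂ} (hi : Inv h) (hi' : Inv h') (hp : Prim h) (hp' : Prim h')
    (hb' : 1 ≤ b') (hk : 1 ≤ k) (hl : 1 ≤ l) (hc : k + l = Fintype.card ι)
    (x : Matrix (Fin k) (Fin k) F) (y : Matrix (Fin l) (Fin l) F) :
    Res (Fin k) (Fin l) (Ind (Fin b) (Fin b') ι (fun a b => h a * h' b)) x y =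
      TT (Fin k) h x * TT (Fin l) h' y + TT (Fin l) h y * TT (Fin k) h' x := by
  rw [mackey_prim hi hi' hp' hb' (k + l + b' + 1) hc (by omega) (by omega) (by omega)]
  congr 1
  · rw [Finset.sum_eq_single 0]
    · rw [Ind_left_empty]
      simp_rw [Res_right_empty]
      rw [TT_mul]
    · intro l1 _ h0
      rw [← Ind_zero_fun (F := F) (α := Fin l1) (β := Fin b') y]
      apply Ind_congr
      intro y1 y2
      rw [hp k l1 hk (by omega), zero_mul]
    · intro h; exfalso; apply h; simp
  · rw [Finset.sum_eq_single 0]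
    · rw [Ind_left_empty]
      simp_rw [Res_left_empty]
      rw [TT_mul]
    · intro l1 _ h0
      rw [← Ind_zero_fun (F := F) (α := Fin l1) (β := Fin b') x]
      apply Ind_congr
      intro y1 y2
      rw [hp l1 l (by omega) hl, zero_mul]
    · intro h; exfalso; apply h; simp

theorem prim_comm {b b' : ℕ} {h : Matrix (Fin b) (Fin b) F → ℂ}
    {h' : Matrix (Fin b') (Fin b') F → ℂ} (hi : Inv h) (hi' : Inv h') (hp : Prim h) (hp' : Prim h')
    (hb : 1 ≤ b) (hb' : 1 ≤ b') (z : Matrix ι ι F) :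
    Ind (Fin b) (Fin b') ι (fun a b => h a * h' b) z =
      Ind (Fin b') (Fin b) ι (fun a b => h' a * h b) z := by
  by_cases hc : b + b' = Fintype.card ι
  swap
  · rw [Ind_zero_of_card (by simpa using hc), Ind_zero_of_card (by rw [add_comm]; simpa using hc)]
  have hc' : b' + b = Fintype.card ι := by omega
  set c : Matrix ι ι F → ℂ := fun z => Ind (Fin b) (Fin b') ι (fun a b => h a * h' b) z -
      Ind (Fin b') (Fin b) ι (fun a b => h' a * h b) z with hcdef
  have hci : Inv c := Inv_sub (Ind_Inv _) (Ind_Inv _)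
  have hres : ∀ k l : ℕ, 1 ≤ k → 1 ≤ l → k + l = Fintype.card ι →
      ∀ (x : Matrix (Fin k) (Fin k) F) (y : Matrix (Fin l) (Fin l) F),
      Res (Fin k) (Fin l) (fun z => (starRingEnd ℂ) (c z)) x y = 0 := by
    intro k l hk hl hkl x y
    rw [Res_star, hcdef, Res_sub, Res_prim_prim hi hi' hp hp' hb' hk hl hkl,
      Res_prim_prim hi' hi hp' hp hb hk hl hkl]
    rw [show ∀ a b c d : ℂ, a * b + c * d - (d * c + b * a) = 0 by intros; ring]
    simp
  have hsum : ∑ z, c z * (starRingEnd ℂ) (c z) = 0 := by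
    have e1 := adjunction (α := Fin b) (β := Fin b') (by simpa using hc) (fun a b => h a * h' b) (Inv_star hci)
    have e2 := adjunction (α := Fin b') (β := Fin b) (by simpa using hc') (fun a b => h' a * h b) (Inv_star hci)
    simp_rw [hres b b' hb hb' hc, mul_zero, Finset.sum_const_zero, mul_zero] at e1
    simp_rw [hres b' b hb' hb hc', mul_zero, Finset.sum_const_zero, mul_zero] at e2
    have : ∀ z, c z * (starRingEnd ℂ) (c z) =
        Ind (Fin b) (Fin b') ι (fun a b => h a * h' b) z * (starRingEnd ℂ) (c z) -
        Ind (Fin b') (Fin b) ι (fun a b => h' a * h b) z * (starRingEnd ℂ) (c z) := by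
      intro z
      rw [← sub_mul]
    simp_rw [this]
    rw [Finset.sum_sub_distrib, e1, e2, sub_zero]
  exact sub_eq_zero.1 (eq_zero_of_sum_star c hsum z)

end Linear

section Span

variable {α β γ δ ι κ κ' : Type} [Fintype α] [DecidableEq α] [Fintype β] [DecidableEq β]
  [Fintype γ] [DecidableEq γ] [Fintype δ] [DecidableEq δ] [Fintype ι] [DecidableEq ι]
  [Fintype κ] [DecidableEq κ] [Fintype κ'] [DecidableEq κ']

theorem sum_fromCols (f : Matrix α (β ⊕ γ) F → ℂ) :
    ∑ M : Matrix α (β ⊕ γ) F, f M = ∑ a : Matrix α β F, ∑ b : Matrix α γ F, f (fromCols a b) := by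
  let e : (Matrix α β F × Matrix α γ F) ≃ Matrix α (β ⊕ γ) F :=
    ⟨fun t => fromCols t.1 t.2, fun M => (M.toCols₁, M.toCols₂), fun t => by simp,
      fun M => by simp⟩
  rw [← Equiv.sum_comp e]
  simp only [Fintype.sum_prod_type]
  rfl

theorem sum_fromRows (f : Matrix (α ⊕ β) γ F → ℂ) :
    ∑ M : Matrix (α ⊕ β) γ F, f M = ∑ a : Matrix α γ F, ∑ b : Matrix β γ F, f (fromRows a b) := by
  let e : (Matrix α γ F × Matrix β γ F) ≃ Matrix (α ⊕ β) γ F :=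
    ⟨fun t => fromRows t.1 t.2, fun M => (M.toRows₁, M.toRows₂), fun t => by simp,
      fun M => by simp⟩
  rw [← Equiv.sum_comp e]
  simp only [Fintype.sum_prod_type]
  rfl

theorem Res_coassoc (hc : Fintype.card β + Fintype.card γ = Fintype.card κ)
    (f : Matrix ι ι F → ℂ) (x : Matrix α α F) (y : Matrix β β F) (w : Matrix γ γ F) :
    Res β γ (Res α κ f x) y w = (qq F ^ (Fintype.card α * Fintype.card β))⁻¹ *
      ∑ u : Matrix α β F, Res (α ⊕ β) γ f (fromBlocks x u 0 y) w := by
  obtain ⟨H⟩ := MIso.exists_of_card (F := F) (α := κ) (β := β ⊕ γ) (by simpa using hc.symm)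
  have e1 : ∀ Y : Matrix (β ⊕ γ) (β ⊕ γ) F, TT (β ⊕ γ) (Res α κ f x) Y = Res α (β ⊕ γ) f x Y := by
    intro Y
    rw [TT_eq (Res_Inv_right f x) H]
    have := Res_conj f (MIso.one F α) H x Y
    rwa [MIso.one_conj] at this
  have e2 : ∀ (u : Matrix α β F) (v : Matrix α γ F) (t : Matrix β γ F),
      TT (α ⊕ (β ⊕ γ)) f (fromBlocks x (fromCols u v) 0 (fromBlocks y t 0 w)) =
      TT ((α ⊕ β) ⊕ γ) f (fromBlocks (fromBlocks x u 0 y) (fromRows v t) 0 w) := by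
    intro u v t
    rw [← TT_conj f (MIso.ofEquiv F (Equiv.sumAssoc α β γ)), MIso.ofEquiv_conj]
    congr 1
    ext i j
    rcases i with (i | i) | i <;> rcases j with (j | j) | j <;> rfl
  have e3 : ∀ (u : Matrix α β F), Res (α ⊕ β) γ f (fromBlocks x u 0 y) w = 
     (qq F ^ ((Fintype.card α + Fintype.card β) * Fintype.card γ))⁻¹ * 
      ∑ v : Matrix α γ F, ∑ t : Matrix β γ F, 
      TT ((α ⊕ β) ⊕ γ) f (fromBlocks (fromBlocks x u 0 y) (fromRows v t) 0 w) := by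
    intro u
    unfold Res
    rw [sum_fromRows, Fintype.card_sum]
  simp_rw [e3]
  rw [Res]
  simp_rw [e1]
  unfold Res
  simp_rw [sum_fromCols, e2, ← Finset.mul_sum]
  rw [← mul_assoc, ← mul_assoc]
  congr 1
  · rw [← mul_inv, ← mul_inv, ← pow_add, ← pow_add, Fintype.card_sum]
    congr 2
    ring
  · rw [Finset.sum_comm]
    apply Finset.sum_congr rfl
    intro u _
    rw [Finset.sum_comm]

theorem orbit_Inv (x : Matrix α α F) :
    Inv (fun x' : Matrix α α F => ∑ G : MIso F α α, ind (G.conj x' = x)) := by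
  intro H x'
  dsimp only
  rw [← Equiv.sum_comp (MIso.compR (α := α) H) (fun G => ind (G.conj x' = x))]
  apply Finset.sum_congr rfl
  intro G _
  rw [← MIso.comp_conj]
  rfl

theorem orbit_sum (x : Matrix α α F) {r : Matrix α α F → ℂ} (hr : Inv r) :
    ∑ x' : Matrix α α F, (∑ G : MIso F α α, ind (G.conj x' = x)) * r x' = NN F α * r x := by
  simp_rw [Finset.sum_mul]
  rw [Finset.sum_comm]
  have : ∀ G : MIso F α α, ∑ x' : Matrix α α F, ind (G.conj x' = x) * r x' = r x := by
    intro G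
    rw [Finset.sum_eq_single (G.symm.conj x)]
    · rw [MIso.conj_symm, ind_true rfl, one_mul, hr]
    · intro x' _ hne
      rw [ind_false, zero_mul]
      intro h
      apply hne
      rw [← h, MIso.symm_conj]
    · simp
  simp_rw [this]
  rw [Finset.sum_const, Finset.card_univ, nsmul_eq_mul]
  rfl

theorem orth_zero {a : ℕ} {c : Matrix (Fin a) (Fin a) F → ℂ} (ha : 1 ≤ a) (hc : Inv c)
    (horth : ∀ a' b' : ℕ, a' + b' = a → 1 ≤ b' → ∀ (g : Matrix (Fin a') (Fin a') F → ℂ)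
      (h : Matrix (Fin b') (Fin b') F → ℂ), Inv g → Inv h → Prim h →
      ∑ z, Ind (Fin a') (Fin b') (Fin a) (fun x y => g x * h y) z * c z = 0) (z : Matrix (Fin a) (Fin a) F) :
    c z = 0 := by
  have main : ∀ l : ℕ, 1 ≤ l → ∀ k : ℕ, k + l = a →
      ∀ (x : Matrix (Fin k) (Fin k) F) (y : Matrix (Fin l) (Fin l) F), Res (Fin k) (Fin l) c x y = 0 := by
    intro l
    induction l using Nat.strong_induction_on with
    | _ l ih =>
    intro hl k hkl x
    have hprim : Prim (Res (Fin k) (Fin l) c x) := by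
      intro l1 l2 h1 h2 y1 y2
      by_cases h12 : l1 + l2 = l
      · rw [Res_coassoc (by simpa using h12), Finset.sum_eq_zero, mul_zero]
        intro u _
        have := Res_conj c (MIso.ofEquiv F (finSumFinEquiv (m := k) (n := l1))).symm (MIso.one F (Fin l2))
          (fromBlocks x u 0 y1) y2
        rw [← this]
        exact ih l2 (by omega) h2 (k + l1) (by omega) _ _
      · exact Res_zero_of_card (by simpa using h12) _ _ _
    have hprim' : Prim (fun y => (starRingEnd ℂ) (Res (Fin k) (Fin l) c x y)) := by
      intro l1 l2 h1 h2 y1 y2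
      rw [Res_star, hprim l1 l2 h1 h2, map_zero]
    have h0 := horth k l hkl hl _ _ (orbit_Inv x) (Inv_star (Res_Inv_right c x)) hprim'
    rw [adjunction (by simpa using hkl) _ hc] at h0
    have h1 := (mul_eq_zero.1 h0).resolve_left
      (mul_ne_zero NN_ne (inv_ne_zero (mul_ne_zero NN_ne NN_ne)))
    have h2 : ∑ x' : Matrix (Fin k) (Fin k) F, (∑ G : MIso F (Fin k) (Fin k), ind (G.conj x' = x)) *
        ∑ y : Matrix (Fin l) (Fin l) F, (starRingEnd ℂ) (Res (Fin k) (Fin l) c x y) *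
          Res (Fin k) (Fin l) c x' y = 0 := by
      rw [← h1]
      apply Finset.sum_congr rfl
      intro x' _
      rw [Finset.mul_sum]
      apply Finset.sum_congr rfl
      intro y _
      ring
    rw [orbit_sum x (r := fun x' => ∑ y : Matrix (Fin l) (Fin l) F,
      (starRingEnd ℂ) (Res (Fin k) (Fin l) c x y) * Res (Fin k) (Fin l) c x' y)] at h2
    · have h3 := (mul_eq_zero.1 h2).resolve_left NN_ne
      simp_rw [mul_comm ((starRingEnd ℂ) _)] at h3
      exact eq_zero_of_sum_star _ h3
    · intro G x'
      apply Finset.sum_congr rfl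
      intro y _
      have h5 : Res (Fin k) (Fin l) c (G.conj x') y = Res (Fin k) (Fin l) c x' y := Res_Inv_left c y G x'
      rw [h5]
  have := main a ha 0 (by omega) 0 z
  rwa [Res_left_empty, TT_self hc] at this

theorem span_ind {a : ℕ} (ha : 1 ≤ a) (P : (Matrix (Fin a) (Fin a) F → ℂ) → Prop)
    (hadd : ∀ f f', Inv f → Inv f' → P f → P f' → P (fun x => f x + f' x))
    (hmul : ∀ (c : ℂ) f, Inv f → P f → P (fun x => c * f x))
    (hgen : ∀ a' b' : ℕ, a' + b' = a → 1 ≤ b' → ∀ (g : Matrix (Fin a') (Fin a') F → ℂ)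
      (h : Matrix (Fin b') (Fin b') F → ℂ), Inv g → Inv h → Prim h →
      P (Ind (Fin a') (Fin b') (Fin a) (fun x y => g x * h y)))
    (f : Matrix (Fin a) (Fin a) F → ℂ) (hf : Inv f) : P f := by
  let gens : Set (Matrix (Fin a) (Fin a) F → ℂ) := {u | ∃ a' b' : ℕ, a' + b' = a ∧ 1 ≤ b' ∧
    ∃ (g : Matrix (Fin a') (Fin a') F → ℂ) (h : Matrix (Fin b') (Fin b') F → ℂ), Inv g ∧ Inv h ∧ Prim h ∧
      u = Ind (Fin a') (Fin b') (Fin a) (fun x y => g x * h y)}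
  have hP0 : P (fun _ => 0) := by
    have h1 := hgen 0 a (by omega) ha (fun _ => 0) (fun _ => 0) (fun _ _ => rfl) (fun _ _ => rfl)
      (by intro k l _ _ x y; simp [Res, TT])
    have h2 := hmul 0 _ (Ind_Inv _) h1
    simpa using h2
  have hS : ∀ u ∈ Submodule.span ℂ gens, Inv u ∧ P u := by
    intro u hu
    induction hu using Submodule.span_induction with
    | mem u hu =>
      obtain ⟨a', b', e, hb, g, h, hg, hh, hp, rfl⟩ := hu
      exact ⟨Ind_Inv _, hgen a' b' e hb g h hg hh hp⟩
    | zero => exact ⟨fun _ _ => rfl, hP0⟩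
    | add u v _ _ hu hv => exact ⟨Inv_add hu.1 hv.1, hadd _ _ hu.1 hv.1 hu.2 hv.2⟩
    | smul c u _ hu => exact ⟨Inv_mul c hu.1, hmul c _ hu.1 hu.2⟩
  suffices f ∈ Submodule.span ℂ gens from (hS f this).2
  by_contra hfS
  obtain ⟨φ, hφf, hφS⟩ := Submodule.exists_dual_map_eq_bot_of_notMem hfS inferInstance
  have hφ : ∀ u, φ u = ∑ z, u z * φ (Pi.single z 1) := by
    intro u
    conv_lhs => rw [LinearMap.pi_apply_eq_sum_univ φ u]
    apply Finset.sum_congr rfl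
    intro z _
    rw [smul_eq_mul]
    congr 2
    funext j
    simp [Pi.single_apply, eq_comm]
  let c : Matrix (Fin a) (Fin a) F → ℂ := fun z => ∑ G : MIso F (Fin a) (Fin a), φ (Pi.single (G.conj z) 1)
  have hci : Inv c := by
    intro H z
    change ∑ G : MIso F (Fin a) (Fin a), φ (Pi.single (G.conj (H.conj z)) 1) =
      ∑ G : MIso F (Fin a) (Fin a), φ (Pi.single (G.conj z) 1)
    rw [← Equiv.sum_comp (MIso.compR (α := Fin a) H) (fun G => φ (Pi.single (G.conj z) 1))]
    apply Finset.sum_congr rfl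
    intro G _
    rw [← MIso.comp_conj]
    rfl
  have hcu : ∀ u, Inv u → ∑ z, u z * c z = NN F (Fin a) * φ u := by
    intro u hu
    simp only [c]
    simp_rw [Finset.mul_sum]
    rw [Finset.sum_comm]
    have : ∀ G : MIso F (Fin a) (Fin a), ∑ z, u z * φ (Pi.single (G.conj z) 1) = φ u := by
      intro G
      rw [hφ u, ← Equiv.sum_comp G.conjE (fun z => u z * φ (Pi.single z 1))]
      apply Finset.sum_congr rfl
      intro z _
      change _ = u (G.conj z) * _
      rw [hu]
      rfl
    simp_rw [this]
    rw [Finset.sum_const, Finset.card_univ, nsmul_eq_mul]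
    rfl
  have hc0 := orth_zero ha hci (by
    intro a' b' e hb g h hg hh hp
    rw [hcu _ (Ind_Inv _)]
    have hm : Ind (Fin a') (Fin b') (Fin a) (fun x y => g x * h y) ∈ Submodule.span ℂ gens :=
      Submodule.subset_span ⟨a', b', e, hb, g, h, hg, hh, hp, rfl⟩
    have : φ (Ind (Fin a') (Fin b') (Fin a) (fun x y => g x * h y)) ∈ (Submodule.span ℂ gens).map φ :=
      Submodule.mem_map_of_mem hm
    rw [hφS, Submodule.mem_bot] at this
    rw [this, mul_zero])
  have := hcu f hf
  simp_rw [hc0, mul_zero, Finset.sum_const_zero] at this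
  exact (mul_ne_zero NN_ne hφf) this.symm

end Span

section Comm
variable {α β γ δ ι κ κ' : Type} [Fintype α] [DecidableEq α] [Fintype β] [DecidableEq β]
  [Fintype γ] [DecidableEq γ] [Fintype δ] [DecidableEq δ] [Fintype ι] [DecidableEq ι]
  [Fintype κ] [DecidableEq κ] [Fintype κ'] [DecidableEq κ']

/-- The Hall product of two functions. -/
noncomputable def mm (ι : Type) [Fintype ι] [DecidableEq ι] (g : Matrix α α F → ℂ)
    (h : Matrix β β F → ℂ) : Matrix ι ι F → ℂ :=
  Ind α β ι (fun x y => g x * h y)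

theorem mm_Inv (g : Matrix α α F → ℂ) (h : Matrix β β F → ℂ) : Inv (mm ι g h) := Ind_Inv _

theorem mm_zero_of_card (hc : Fintype.card α + Fintype.card β ≠ Fintype.card ι)
    (g : Matrix α α F → ℂ) (h : Matrix β β F → ℂ) (z : Matrix ι ι F) : mm ι g h z = 0 :=
  Ind_zero_of_card hc _ _

theorem mm_assoc (h1 : Fintype.card α + Fintype.card β = Fintype.card κ)
    (h2 : Fintype.card β + Fintype.card γ = Fintype.card κ')
    (g : Matrix α α F → ℂ) (h : Matrix β β F → ℂ) (k : Matrix γ γ F → ℂ) :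
    mm ι (mm κ g h) k = mm ι g (mm κ' h k) := by
  funext z
  have e1 := assocL (ι := ι) h1 (fun a b c => g a * h b * k c) z
  have e2 := assocR (ι := ι) h2 (fun a b c => g a * h b * k c) z
  rw [← e2] at e1
  refine Eq.trans ?_ (e1.trans ?_)
  · apply Ind_congr
    intro w y
    unfold mm
    rw [mul_comm, ← Ind_mul]
    apply Ind_congr
    intro a b
    ring
  · apply Ind_congr
    intro w y
    unfold mm
    rw [← Ind_mul]
    apply Ind_congr
    intro a b
    ring

theorem mm_add_left (g g' : Matrix α α F → ℂ) (h : Matrix β β F → ℂ) (z : Matrix ι ι F) :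
    mm ι (fun x => g x + g' x) h z = mm ι g h z + mm ι g' h z := by
  unfold mm
  rw [← Ind_add]
  apply Ind_congr
  intro x y
  ring

theorem mm_add_right (g : Matrix α α F → ℂ) (h h' : Matrix β β F → ℂ) (z : Matrix ι ι F) :
    mm ι g (fun x => h x + h' x) z = mm ι g h z + mm ι g h' z := by
  unfold mm
  rw [← Ind_add]
  apply Ind_congr
  intro x y
  ring

theorem mm_mul_left (c : ℂ) (g : Matrix α α F → ℂ) (h : Matrix β β F → ℂ) (z : Matrix ι ι F) :
    mm ι (fun x => c * g x) h z = c * mm ι g h z := by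
  unfold mm
  rw [← Ind_mul]
  apply Ind_congr
  intro x y
  ring

theorem mm_mul_right (c : ℂ) (g : Matrix α α F → ℂ) (h : Matrix β β F → ℂ) (z : Matrix ι ι F) :
    mm ι g (fun x => c * h x) z = c * mm ι g h z := by
  unfold mm
  rw [← Ind_mul]
  apply Ind_congr
  intro x y
  ring

theorem mm_comm_prim {b : ℕ} (hb : 1 ≤ b) {h : Matrix (Fin b) (Fin b) F → ℂ} (hh : Inv h) (hp : Prim h) :
    ∀ (a : ℕ) (g : Matrix (Fin a) (Fin a) F → ℂ), Inv g → ∀ (c : ℕ),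
      mm (Fin c) g h = mm (Fin c) h g := by
  intro a
  induction a using Nat.strong_induction_on with
  | _ a ih =>
  intro g hg
  rcases Nat.eq_zero_or_pos a with rfl | ha
  · intro c
    funext z
    unfold mm
    rw [Ind_left_empty, Ind_right_empty]
    apply TT_congr
    intro x
    rw [mul_comm]
  · refine span_ind ha (fun g => ∀ c, mm (Fin c) g h = mm (Fin c) h g) ?_ ?_ ?_ g hg
    · intro f f' _ _ h1 h2 c
      funext z
      rw [mm_add_left, mm_add_right, h1, h2]
    · intro s f _ h1 c
      funext z
      rw [mm_mul_left, mm_mul_right, h1]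
    · intro a' b' e hb' g' h' hg' hh' hp' c
      change mm (Fin c) (mm (Fin a) g' h') h = mm (Fin c) h (mm (Fin a) g' h')
      have e1 : mm (Fin (b' + b)) h' h = mm (Fin (b' + b)) h h' := by
        funext z
        exact prim_comm hh' hh hp' hp hb' hb z
      rw [mm_assoc (κ' := Fin (b' + b)) (by simpa using e) (by simp), e1,
        ← mm_assoc (κ := Fin (a' + b)) (by simp) (by simp; omega),
        ih a' (by omega) g' hg',
        mm_assoc (κ' := Fin a) (by simp; omega) (by simpa using e)]

end Comm

section EOp
variable {α β γ δ ι κ κ' : Type} [Fintype α] [DecidableEq α] [Fintype β] [DecidableEq β]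
  [Fintype γ] [DecidableEq γ] [Fintype δ] [DecidableEq δ] [Fintype ι] [DecidableEq ι]
  [Fintype κ] [DecidableEq κ] [Fintype κ'] [DecidableEq κ']

/-- Axioms for a duality family, in terms of the cast-free operations. -/
structure DD (m : ℕ) (D : ∀ n : ℕ, (Matrix (Fin n) (Fin n) F → ℂ) → (Matrix (Fin n) (Fin n) F → ℂ)) :
    Prop where
  map : ∀ n, n ≤ m → ∀ f, Inv f → Inv (D n f)
  add : ∀ n, n ≤ m → ∀ f g, Inv f → Inv g → ∀ z, D n (fun x => f x + g x) z = D n f z + D n g z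
  smul : ∀ n, n ≤ m → ∀ (c : ℂ) f, Inv f → ∀ z, D n (fun x => c * f x) z = c * D n f z
  prod : ∀ a b n, a + b = n → n ≤ m → ∀ (g : Matrix (Fin a) (Fin a) F → ℂ)
    (h : Matrix (Fin b) (Fin b) F → ℂ), Inv g → Inv h →
    D n (mm (Fin n) g h) = mm (Fin n) (D a g) (D b h)
  cusp : ∀ n, 1 ≤ n → n ≤ m → ∀ f, Inv f → Prim f → ∀ z, D n f z = (-1) ^ (n - 1) * f z

variable {m : ℕ} {D : ∀ n : ℕ, (Matrix (Fin n) (Fin n) F → ℂ) → (Matrix (Fin n) (Fin n) F → ℂ)}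

theorem Inv_zero : Inv (fun _ : Matrix α α F => (0 : ℂ)) := fun _ _ => rfl

theorem DD.zero (hD : DD m D) (n : ℕ) (hn : n ≤ m) (z : Matrix (Fin n) (Fin n) F) :
    D n (fun _ => 0) z = 0 := by
  have := hD.smul n hn 0 (fun _ => 0) Inv_zero z
  simpa using this

theorem Inv_sum {S : Type} (s : Finset S) (f : S → Matrix α α F → ℂ) (hf : ∀ i ∈ s, Inv (f i)) :
    Inv (fun x => ∑ i ∈ s, f i x) := by
  intro G x
  exact Finset.sum_congr rfl (fun i hi => hf i hi G x)

theorem DD.sum (hD : DD m D) (n : ℕ) (hn : n ≤ m) {S : Type} (s : Finset S)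
    (f : S → Matrix (Fin n) (Fin n) F → ℂ) (hf : ∀ i, Inv (f i)) (z : Matrix (Fin n) (Fin n) F) :
    D n (fun x => ∑ i ∈ s, f i x) z = ∑ i ∈ s, D n (f i) z := by
  induction s using Finset.induction_on with
  | empty => simpa using hD.zero n hn z
  | insert a s ha ih =>
    simp_rw [Finset.sum_insert ha]
    rw [hD.add n hn _ _ (hf a) (Inv_sum s f (fun i _ => hf i)), ih]

theorem DD.Ind (hD : DD m D) (n : ℕ) (hn : n ≤ m)
    (p : Matrix α α F → Matrix β β F → Matrix (Fin n) (Fin n) F → ℂ) (hp : ∀ x y, Inv (p x y))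
    (x : Matrix ι ι F) (z : Matrix (Fin n) (Fin n) F) :
    D n (fun w => HCPaper.Ind α β ι (fun a b => p a b w) x) z =
      HCPaper.Ind α β ι (fun a b => D n (p a b) z) x := by
  unfold HCPaper.Ind
  rw [hD.smul n hn _ _ (Inv_sum _ _ (fun G _ => Inv_mul _ (hp _ _))),
    hD.sum n hn _ _ (fun G => Inv_mul _ (hp _ _))]
  congr 1
  apply Finset.sum_congr rfl
  intro G _
  rw [hD.smul n hn _ _ (hp _ _)]

theorem mm_zero_left (h : Matrix β β F → ℂ) (g : Matrix α α F → ℂ) (hg : ∀ x, g x = 0) (z : Matrix ι ι F) :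
    mm ι g h z = 0 := by
  unfold mm
  rw [Ind_congr (p' := fun _ _ => 0) (by intro x y; rw [hg, zero_mul]), Ind_zero_fun]

theorem termA {k l l1 a b n : ℕ} (hn : a + b = n)
    (Q : Matrix (Fin k) (Fin k) F → Matrix (Fin l1) (Fin l1) F → ℂ)
    (h : Matrix (Fin b) (Fin b) F → ℂ) (z : Matrix (Fin n) (Fin n) F) :
    Ind (Fin k) (Fin l) (Fin n) (fun x y =>
      Ind (Fin l1) (Fin b) (Fin l) (fun y1 y2 => Q x y1 * h y2) y) z =
    if l1 + b = l then mm (Fin n) (Ind (Fin k) (Fin l1) (Fin a) Q) h z else 0 := by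
  split_ifs with hl
  · rw [assocR (by simpa using hl) (fun x y1 y2 => Q x y1 * h y2)]
    by_cases hk : k + l1 = a
    · rw [← assocL (κ := Fin a) (by simpa using hk)]
      unfold mm
      apply Ind_congr
      intro w y
      rw [mul_comm, ← Ind_mul]
      apply Ind_congr
      intro x y
      ring
    · rw [mm_zero_left _ _ (fun x => Ind_zero_of_card (by simpa using hk) _ _), Ind3_zero_of_card]
      simp; omega
  · rw [← Ind_zero_fun (α := Fin k) (β := Fin l) z]
    apply Ind_congr
    intro x y
    exact Ind_zero_of_card (by simpa using hl) _ _

theorem termB {k l k1 a b n : ℕ} (hb : 1 ≤ b) (hn : a + b = n)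
    (Q : Matrix (Fin k1) (Fin k1) F → Matrix (Fin l) (Fin l) F → ℂ) (hQ : ∀ x, Inv (Q x))
    (h : Matrix (Fin b) (Fin b) F → ℂ) (hh : Inv h) (hp : Prim h) (z : Matrix (Fin n) (Fin n) F) :
    Ind (Fin k) (Fin l) (Fin n) (fun x y =>
      Ind (Fin k1) (Fin b) (Fin k) (fun x1 x2 => Q x1 y * h x2) x) z =
    if k1 + b = k then mm (Fin n) (Ind (Fin k1) (Fin l) (Fin a) Q) h z else 0 := by
  split_ifs with hk
  · have eA := termA (l := l + b) hn Q h z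
    rw [if_pos rfl] at eA
    rw [← eA, assocL (by simpa using hk) (fun x1 x2 y => Q x1 y * h x2),
      ← assocR (κ := Fin (l + b)) (by simp; omega)]
    apply Ind_congr
    intro x w
    have := congrFun (mm_comm_prim hb hh hp l (Q x) (hQ x) (l + b)) w
    unfold mm at this
    rw [this]
    apply Ind_congr
    intro x y
    ring
  · rw [← Ind_zero_fun (α := Fin k) (β := Fin l) z]
    apply Ind_congr
    intro x y
    exact Ind_zero_of_card (by simpa using hk) _ _

/-- The alternating sum operator. -/
noncomputable def EE (m : ℕ)
    (D : ∀ n : ℕ, (Matrix (Fin n) (Fin n) F → ℂ) → (Matrix (Fin n) (Fin n) F → ℂ)) (n : ℕ)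
    (f : Matrix (Fin n) (Fin n) F → ℂ) (z : Matrix (Fin n) (Fin n) F) : ℂ :=
  ∑ k ∈ Finset.range (m + 1), ∑ l ∈ Finset.range (m + 1), (-1) ^ k *
    Ind (Fin k) (Fin l) (Fin n) (fun x y => D l (Res (Fin k) (Fin l) f x) y) z

theorem EE_term (hD : DD m D) {a b n k l : ℕ} (hab : a + b = n) (hb : 1 ≤ b) (hn : n ≤ m)
    (hk : k < m + 1) (hl : l < m + 1)
    (g : Matrix (Fin a) (Fin a) F → ℂ) (h : Matrix (Fin b) (Fin b) F → ℂ) (hg : Inv g) (hh : Inv h)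
    (hp : Prim h) (z : Matrix (Fin n) (Fin n) F) :
    Ind (Fin k) (Fin l) (Fin n) (fun x y => D l (Res (Fin k) (Fin l) (mm (Fin n) g h) x) y) z =
    ∑ l1 ∈ Finset.range (m + 1), (if l1 + b = l then mm (Fin n) (Ind (Fin k) (Fin l1) (Fin a)
        (fun x y => D l1 (Res (Fin k) (Fin l1) g x) y)) (D b h) z else 0) +
    ∑ k1 ∈ Finset.range (m + 1), (if k1 + b = k then mm (Fin n) (Ind (Fin k1) (Fin l) (Fin a)
        (fun x y => D l (Res (Fin k1) (Fin l) g x) y)) h z else 0) := by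
  have hQ : ∀ (k1 : ℕ) (x : Matrix (Fin k1) (Fin k1) F), Inv (D l (Res (Fin k1) (Fin l) g x)) :=
    fun k1 x => hD.map l (by omega) _ (Res_Inv_right _ _)
  have eA : ∀ l1, _ := fun l1 => (termA (k := k) (l := l) (l1 := l1) hab
    (fun x y => D l1 (Res (Fin k) (Fin l1) g x) y) (D b h) z).symm
  have eB : ∀ k1, _ := fun k1 => (termB (k := k) (l := l) (k1 := k1) hb hab
    (fun x y => D l (Res (Fin k1) (Fin l) g x) y) (hQ k1) h hh hp z).symm
  simp_rw [eA, eB]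
  by_cases hkl : k + l = n
  · rw [← Ind_sum, ← Ind_sum, ← Ind_add]
    apply Ind_congr
    intro x y
    have e1 : Res (Fin k) (Fin l) (mm (Fin n) g h) x = fun y =>
        (∑ l1 ∈ Finset.range (m + 1), Ind (Fin l1) (Fin b) (Fin l)
          (fun y1 y2 => Res (Fin k) (Fin l1) g x y1 * h y2) y) +
        ∑ k1 ∈ Finset.range (m + 1), Ind (Fin k1) (Fin b) (Fin k)
          (fun x1 x2 => Res (Fin k1) (Fin l) g x1 y * h x2) x := by
      funext y
      exact mackey_prim hg hh hp hb (m + 1) (by simpa using hkl) hk hl (by omega) x y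
    have hI1 : ∀ l1, Inv (Ind (Fin l1) (Fin b) (Fin l)
          (fun y1 y2 => Res (Fin k) (Fin l1) g x y1 * h y2)) := fun l1 => Ind_Inv _
    have hI3 : ∀ (k1 : ℕ) (x1 : Matrix (Fin k1) (Fin k1) F) (x2 : Matrix (Fin b) (Fin b) F),
        Inv (fun y => h x2 * Res (Fin k1) (Fin l) g x1 y) :=
      fun k1 x1 x2 => Inv_mul _ (Res_Inv_right _ _)
    have hI3' : ∀ (k1 : ℕ) (x1 : Matrix (Fin k1) (Fin k1) F) (x2 : Matrix (Fin b) (Fin b) F),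
        Inv (fun y => Res (Fin k1) (Fin l) g x1 y * h x2) := by
      intro k1 x1 x2
      have := hI3 k1 x1 x2
      simpa only [mul_comm] using this
    have hI2 : ∀ k1, Inv (fun y => Ind (Fin k1) (Fin b) (Fin k)
          (fun x1 x2 => Res (Fin k1) (Fin l) g x1 y * h x2) x) := by
      intro k1 G y
      apply Ind_congr
      intro x1 x2
      exact hI3' k1 x1 x2 G y
    rw [e1, hD.add l (by omega) _ _ (Inv_sum _ _ (fun i _ => hI1 i)) (Inv_sum _ _ (fun i _ => hI2 i)),
      hD.sum l (by omega) _ _ hI1, hD.sum l (by omega) _ _ hI2]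
    congr 1
    · apply Finset.sum_congr rfl
      intro l1 _
      by_cases hl1 : l1 + b = l
      · exact congrFun (hD.prod l1 b l hl1 (by omega) _ h (Res_Inv_right g x) hh) y
      · rw [Ind_zero_of_card (by simpa using hl1)]
        have : Ind (Fin l1) (Fin b) (Fin l) (fun y1 y2 => Res (Fin k) (Fin l1) g x y1 * h y2) =
          fun _ => 0 := funext fun y => Ind_zero_of_card (by simpa using hl1) _ _
        rw [this, hD.zero l (by omega)]
    · apply Finset.sum_congr rfl
      intro k1 _
      rw [hD.Ind l (by omega) (fun x1 x2 y => Res (Fin k1) (Fin l) g x1 y * h x2) (hI3' k1)]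
      apply Ind_congr
      intro x1 x2
      rw [mul_comm, ← hD.smul l (by omega) _ _ (Res_Inv_right g x1)]
      simp only [mul_comm]
  · rw [Ind_zero_of_card (by simpa using hkl), Finset.sum_eq_zero, Finset.sum_eq_zero, add_zero]
    · intro i _
      exact Ind_zero_of_card (by simpa using hkl) _ _
    · intro i _
      exact Ind_zero_of_card (by simpa using hkl) _ _

theorem EE_zero_gen (hD : DD m D) {a b n : ℕ} (hab : a + b = n) (hb : 1 ≤ b) (hn : n ≤ m)
    (g : Matrix (Fin a) (Fin a) F → ℂ) (h : Matrix (Fin b) (Fin b) F → ℂ) (hg : Inv g) (hh : Inv h)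
    (hp : Prim h) (z : Matrix (Fin n) (Fin n) F) : EE m D n (mm (Fin n) g h) z = 0 := by
  unfold EE
  set M : ℕ → ℕ → ℂ := fun k l => mm (Fin n) (Ind (Fin k) (Fin l) (Fin a)
        (fun x y => D l (Res (Fin k) (Fin l) g x) y)) h z with hM
  have hM0 : ∀ k l, k + l ≠ a → M k l = 0 := by
    intro k l hkl
    exact mm_zero_left _ _ (fun x => Ind_zero_of_card (by simpa using hkl) _ _) _
  have hMD : ∀ k l, mm (Fin n) (Ind (Fin k) (Fin l) (Fin a)
        (fun x y => D l (Res (Fin k) (Fin l) g x) y)) (D b h) z = (-1) ^ (b - 1) * M k l := by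
    intro k l
    have : D b h = fun z => (-1) ^ (b - 1) * h z := funext fun z => hD.cusp b hb (by omega) h hh hp z
    rw [this, mm_mul_right]
  have e : ∀ k ∈ Finset.range (m + 1), ∀ l ∈ Finset.range (m + 1), (-1 : ℂ) ^ k *
      Ind (Fin k) (Fin l) (Fin n) (fun x y => D l (Res (Fin k) (Fin l) (mm (Fin n) g h) x) y) z =
      ∑ l1 ∈ Finset.range (m + 1), (if l1 + b = l then (-1) ^ k * ((-1) ^ (b - 1) * M k l1) else 0) +
      ∑ k1 ∈ Finset.range (m + 1), (if k1 + b = k then (-1) ^ k * M k1 l else 0) := by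
    intro k hk l hl
    rw [EE_term hD hab hb hn (Finset.mem_range.1 hk) (Finset.mem_range.1 hl) g h hg hh hp z, mul_add,
      Finset.mul_sum, Finset.mul_sum]
    congr 1
    · apply Finset.sum_congr rfl
      intro i _
      rw [mul_ite, mul_zero, hMD]
    · apply Finset.sum_congr rfl
      intro i _
      rw [mul_ite, mul_zero]
  rw [Finset.sum_congr rfl (fun k hk => Finset.sum_congr rfl (fun l hl => e k hk l hl))]
  simp_rw [Finset.sum_add_distrib]
  have s1 : ∑ k ∈ Finset.range (m + 1), ∑ l ∈ Finset.range (m + 1), ∑ l1 ∈ Finset.range (m + 1),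
      (if l1 + b = l then (-1 : ℂ) ^ k * ((-1) ^ (b - 1) * M k l1) else 0) =
      ∑ k ∈ Finset.range (m + 1), ∑ l1 ∈ Finset.range (m + 1), (-1 : ℂ) ^ k * ((-1) ^ (b - 1) * M k l1) := by
    apply Finset.sum_congr rfl
    intro k _
    rw [Finset.sum_comm]
    apply Finset.sum_congr rfl
    intro l1 _
    rw [Finset.sum_ite_eq]
    split_ifs with hh
    · rfl
    · rw [Finset.mem_range] at hh
      rw [hM0 k l1 (by omega)]
      simp
  have s2 : ∑ k ∈ Finset.range (m + 1), ∑ l ∈ Finset.range (m + 1), ∑ k1 ∈ Finset.range (m + 1),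
      (if k1 + b = k then (-1 : ℂ) ^ k * M k1 l else 0) =
      ∑ k1 ∈ Finset.range (m + 1), ∑ l ∈ Finset.range (m + 1), (-1 : ℂ) ^ (k1 + b) * M k1 l := by
    rw [Finset.sum_comm]
    conv_rhs => rw [Finset.sum_comm]
    apply Finset.sum_congr rfl
    intro l _
    rw [Finset.sum_comm]
    apply Finset.sum_congr rfl
    intro k1 _
    rw [Finset.sum_ite_eq]
    split_ifs with hh
    · rfl
    · rw [Finset.mem_range] at hh
      rw [hM0 k1 l (by omega)]
      simp
  rw [s1, s2, ← Finset.sum_add_distrib]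
  apply Finset.sum_eq_zero
  intro k _
  rw [← Finset.sum_add_distrib]
  apply Finset.sum_eq_zero
  intro l _
  obtain ⟨c, rfl⟩ : ∃ c, b = c + 1 := ⟨b - 1, by omega⟩
  rw [Nat.add_sub_cancel, pow_add, pow_succ]
  ring

theorem EE_zero (hD : DD m D) {n : ℕ} (h1 : 1 ≤ n) (hn : n ≤ m)
    (f : Matrix (Fin n) (Fin n) F → ℂ) (hf : Inv f) (z : Matrix (Fin n) (Fin n) F) : EE m D n f z = 0 := by
  refine span_ind h1 (fun f => ∀ z, EE m D n f z = 0) ?_ ?_ ?_ f hf z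
  · intro f f' _ _ hf hf' z
    have : EE m D n (fun x => f x + f' x) z = EE m D n f z + EE m D n f' z := by
      unfold EE
      rw [← Finset.sum_add_distrib]
      apply Finset.sum_congr rfl
      intro k _
      rw [← Finset.sum_add_distrib]
      apply Finset.sum_congr rfl
      intro l hl
      rw [← mul_add, ← Ind_add]
      congr 1
      apply Ind_congr
      intro x y
      rw [← hD.add l (by have := Finset.mem_range.1 hl; omega) _ _ (Res_Inv_right _ _) (Res_Inv_right _ _)]
      congr 1
      funext y
      exact Res_add _ _ _ _
    rw [this, hf, hf', add_zero]
  · intro c f _ hf z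
    have : EE m D n (fun x => c * f x) z = c * EE m D n f z := by
      unfold EE
      rw [Finset.mul_sum]
      apply Finset.sum_congr rfl
      intro k _
      rw [Finset.mul_sum]
      apply Finset.sum_congr rfl
      intro l hl
      rw [mul_left_comm]
      congr 1
      rw [← Ind_mul]
      apply Ind_congr
      intro x y
      rw [← hD.smul l (by have := Finset.mem_range.1 hl; omega) _ _ (Res_Inv_right _ _)]
      congr 1
      funext y
      exact Res_mul _ _ _ _
    rw [this, hf, mul_zero]
  · intro a b e hb g h hg hh hp z
    exact EE_zero_gen hD e hb hn g h hg hh hp z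

theorem D_rec (hD : DD m D) {n : ℕ} (h1 : 1 ≤ n) (hn : n ≤ m)
    (f : Matrix (Fin n) (Fin n) F → ℂ) (hf : Inv f) (z : Matrix (Fin n) (Fin n) F) :
    D n f z = ∑ k ∈ Finset.range n, (-1) ^ k *
      Ind (Fin (k + 1)) (Fin (n - 1 - k)) (Fin n)
        (fun x y => D (n - 1 - k) (Res (Fin (k + 1)) (Fin (n - 1 - k)) f x) y) z := by
  have h0 := EE_zero hD h1 hn f hf z
  unfold EE at h0
  set T : ℕ → ℕ → ℂ := fun k l => (-1) ^ k *
    Ind (Fin k) (Fin l) (Fin n) (fun x y => D l (Res (Fin k) (Fin l) f x) y) z with hT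
  have hT0 : ∀ k l, k + l ≠ n → T k l = 0 := by
    intro k l hkl
    simp only [T]
    rw [Ind_zero_of_card (by simpa using hkl), mul_zero]
  have hone : ∀ k ∈ Finset.range (m + 1), ∑ l ∈ Finset.range (m + 1), T k l =
      if k ≤ n then T k (n - k) else 0 := by
    intro k _
    split_ifs with hk
    · apply Finset.sum_eq_single
      · intro l _ hl
        exact hT0 k l (by omega)
      · intro hh
        rw [Finset.mem_range] at hh
        omega
    · apply Finset.sum_eq_zero
      intro l _
      exact hT0 k l (by omega)
  rw [Finset.sum_congr rfl hone, ← Finset.sum_filter] at h0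
  have : (Finset.range (m + 1)).filter (fun k => k ≤ n) = Finset.range (n + 1) := by
    ext k
    simp only [Finset.mem_filter, Finset.mem_range]
    omega
  rw [this, Finset.sum_range_succ'] at h0
  have hz : T 0 (n - 0) = D n f z := by
    simp only [T, pow_zero, one_mul, Nat.sub_zero]
    rw [Ind_left_empty]
    have : Res (Fin 0) (Fin n) f 0 = f := by
      funext y
      rw [Res_left_empty, TT_self hf]
    rw [this]
    exact TT_self (hD.map n hn f hf) z
  rw [hz] at h0
  rw [eq_neg_of_add_eq_zero_right h0, ← Finset.sum_neg_distrib]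
  apply Finset.sum_congr rfl
  intro k _
  have e : n - (k + 1) = n - 1 - k := by omega
  simp only [T, e, pow_succ]
  ring

end EOp

section Bridge

/-- Invertible matrices as matrix isomorphisms. -/
def glE (n : ℕ) : Matrix.GeneralLinearGroup (Fin n) F ≃ MIso F (Fin n) (Fin n) where
  toFun g := ⟨g.1, g.2, g.3, g.4⟩
  invFun G := ⟨G.m, G.i, G.mi, G.im⟩
  left_inv _ := rfl
  right_inv _ := rfl

theorem glE_conj {n : ℕ} (g : Matrix.GeneralLinearGroup (Fin n) F) (x : gl F n) :
    (glE n g).conj x = conjM g x := rfl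

theorem Invariant_iff {n : ℕ} (f : gl F n → ℂ) : Invariant n f ↔ Inv f := by
  constructor
  · intro h G x
    exact h ((glE n).symm G) x
  · intro h g x
    exact h (glE n g) x

theorem castM_self {n : ℕ} (e : n = n) (x : gl F n) : castM e x = x := rfl

theorem castFun_self {n : ℕ} (e : n = n) (f : gl F n → ℂ) : castFun e f = f := rfl

theorem castM_eq {m n : ℕ} (h : m = n) (x : gl F m) :
    castM h x = (MIso.ofEquiv F (finCongr h.symm)).conj x := by
  rw [MIso.ofEquiv_conj]
  rfl

theorem blk_eq (k l : ℕ) (x : gl F (k + l)) :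
    blk k l x = (MIso.ofEquiv F (finSumFinEquiv (m := k) (n := l))).conj x := by
  rw [MIso.ofEquiv_conj]
  rfl

theorem sum_gl (k l : ℕ) (φ : MIso F (Fin k ⊕ Fin l) (Fin (k + l)) → ℂ) :
    ∑ g : Matrix.GeneralLinearGroup (Fin (k + l)) F,
      φ ((MIso.ofEquiv F finSumFinEquiv).comp (glE (k + l) g)) = ∑ G, φ G := by
  rw [← Equiv.sum_comp ((glE (F := F) (k + l)).trans
    (MIso.compL (MIso.ofEquiv F (finSumFinEquiv (m := k) (n := l))))) φ]
  rfl

theorem Pcard_eq (k l : ℕ) : (Pcard F k l : ℂ) =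
    NN F (Fin k) * NN F (Fin l) * qq F ^ (Fintype.card (Fin k) * Fintype.card (Fin l)) := by
  have h1 : (Pcard F k l : ℂ) = ∑ g : Matrix.GeneralLinearGroup (Fin (k + l)) F,
      ind (IsBUT k l (g : Matrix (Fin (k + l)) (Fin (k + l)) F)) := by
    unfold Pcard ind
    rw [Nat.card_eq_fintype_card, Fintype.card_subtype, Finset.sum_boole]
  rw [h1]
  have h2 : ∑ G : MIso F (Fin k ⊕ Fin l) (Fin k ⊕ Fin l), ind (G.m.toBlocks₂₁ = 0) * (1 : ℂ) =
      NN F (Fin k) * NN F (Fin l) * qq F ^ (Fintype.card (Fin k) * Fintype.card (Fin l)) := by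
    rw [sum_but rfl]
    simp only [Finset.sum_const, Finset.card_univ, nsmul_eq_mul, mul_one]
    rw [card_Mat]
    unfold NN
    ring
  rw [← h2]
  simp_rw [mul_one]
  rw [← Equiv.sum_comp (((glE (F := F) (k + l)).trans
    (MIso.compL (MIso.ofEquiv F (finSumFinEquiv (m := k) (n := l))))).trans
    (MIso.compR (MIso.ofEquiv F (finSumFinEquiv (m := k) (n := l))).symm))]
  apply Finset.sum_congr rfl
  intro g _
  apply ind_congr
  unfold IsBUT
  rw [blk_eq]
  exact Iff.rfl

theorem TT_cast {m n : ℕ} (h : m = n) {f : gl F n → ℂ} (hf : Inv f) (z : gl F m) :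
    TT (Fin m) f z = f (castM h z) := by
  rw [castM_eq, TT_eq hf]

theorem HCind_eq (k l : ℕ) (p : gl F k → gl F l → ℂ) (h1 : ∀ x, Inv (p x))
    (h2 : ∀ y, Inv (fun x => p x y)) :
    HCind k l (fun q => p q.1 q.2) = Ind (Fin k) (Fin l) (Fin (k + l)) p := by
  funext z
  unfold HCind
  split_ifs with hk hl
  · subst hk
    rw [Ind_left_empty, TT_cast (by omega) (h1 0)]
  · subst hl
    rw [Ind_right_empty, TT_cast (by omega) (h2 0)]
  · rw [Pcard_eq]
    unfold Ind
    refine congrArg (fun t => (NN F (Fin k) * NN F (Fin l) *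
      qq F ^ (Fintype.card (Fin k) * Fintype.card (Fin l)))⁻¹ * t) ?_
    rw [← sum_gl k l]
    apply Finset.sum_congr rfl
    intro g _
    rw [MIso.comp_conj, glE_conj, ← blk_eq]
    by_cases hb : IsBUT k l (conjM g z)
    · rw [ind_true (show (blk k l (conjM g z)).toBlocks₂₁ = 0 from hb), one_mul, if_pos hb]
      rfl
    · rw [ind_false (show ¬ (blk k l (conjM g z)).toBlocks₂₁ = 0 from hb), zero_mul, if_neg hb]

theorem HCres_eq (k l : ℕ) (f : gl F (k + l) → ℂ) (hf : Inv f) (x : gl F k) (y : gl F l) :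
    HCres k l f (x, y) = Res (Fin k) (Fin l) f x y := by
  unfold HCres
  split_ifs with hk hl
  · subst hk
    rw [Res_left_empty, TT_cast (by omega) hf]
  · subst hl
    rw [Res_right_empty, TT_cast (by omega) hf]
  · unfold Res
    simp only [Fintype.card_fin]
    congr 1
    apply Finset.sum_congr rfl
    intro u _
    rw [TT_eq hf (MIso.ofEquiv F (finSumFinEquiv (m := k) (n := l)).symm), MIso.ofEquiv_conj]
    rfl

theorem Prim_PreCuspidal {n : ℕ} (f : gl F n → ℂ) (hf : Inv f) (hp : PreCuspidal n f) : Prim f := by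
  intro k l hk hl x y
  by_cases e : k + l = n
  · subst e
    have := congrFun (hp k l hk hl rfl) (x, y)
    rw [castFun_self, HCres_eq k l f hf] at this
    exact this
  · exact Res_zero_of_card (by simpa using e) _ _ _

theorem PreCuspidal_of_Prim {n : ℕ} (f : gl F n → ℂ) (hf : Inv f) (hp : Prim f) : PreCuspidal n f := by
  intro k l hk hl e
  subst e
  funext ⟨x, y⟩
  rw [castFun_self, HCres_eq k l f hf, hp k l hk hl]
  rfl

/-- Cast-free version of `RcompRes`. -/
noncomputable def RR : (L : List ℕ) → (n : ℕ) → (gl F n → ℂ) → gl F n → ℂ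
  | [], _, f => f
  | (k :: L), n, f => Ind (Fin k) (Fin L.sum) (Fin n) (fun x y =>
      RR L L.sum (Res (Fin k) (Fin L.sum) f x) y)

theorem RR_Inv (L : List ℕ) (n : ℕ) (f : gl F n → ℂ) (hf : Inv f) : Inv (RR L n f) := by
  cases L with
  | nil => exact hf
  | cons k L => exact Ind_Inv _

theorem RcompRes_eq (L : List ℕ) (f : gl F L.sum → ℂ) (hf : Inv f) :
    RcompRes L f = RR L L.sum f := by
  induction L with
  | nil => rfl
  | cons k L ih =>
    have key : ∀ (N : ℕ) (e : N = k + L.sum) (f : gl F N → ℂ), Inv f →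
        castFun e.symm (HCind k L.sum fun p =>
          RcompRes L (fun y => HCres k L.sum (castFun e f) (p.1, y)) p.2) =
        Ind (Fin k) (Fin L.sum) (Fin N) (fun x y =>
          RR L L.sum (Res (Fin k) (Fin L.sum) f x) y) := by
      intro N e f hf
      subst e
      rw [castFun_self, castFun_self]
      rw [← HCind_eq k L.sum (fun x y => RR L L.sum (Res (Fin k) (Fin L.sum) f x) y)]
      · congr 1
        funext p
        have e1 : (fun y => HCres k L.sum f (p.1, y)) = Res (Fin k) (Fin L.sum) f p.1 :=
          funext fun y => HCres_eq k L.sum f hf p.1 y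
        rw [e1, ih _ (Res_Inv_right _ _)]
      · intro x
        exact RR_Inv _ _ _ (Res_Inv_right _ _)
      · intro y G x
        have e1 : Res (Fin k) (Fin L.sum) f (G.conj x) = Res (Fin k) (Fin L.sum) f x :=
          funext fun w => Res_Inv_left f w G x
        show RR L L.sum (Res (Fin k) (Fin L.sum) f (G.conj x)) y = _
        rw [e1]
    exact key _ List.sum_cons f hf

theorem Dual_eq (n : ℕ) (f : gl F n → ℂ) (hf : Inv f) (z : gl F n) :
    Dual n f z = ∑ c : Composition n, (-1 : ℂ) ^ (n - c.length) * RR c.blocks n f z := by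
  unfold Dual
  rw [Finset.sum_apply]
  apply Finset.sum_congr rfl
  intro c _
  rw [Pi.smul_apply, smul_eq_mul]
  congr 1
  have key : ∀ (L : List ℕ) (n : ℕ) (e : L.sum = n) (f : gl F n → ℂ), Inv f →
      castFun e (RcompRes L (castFun e.symm f)) = RR L n f := by
    intro L n e f hf
    subst e
    rw [castFun_self, castFun_self, RcompRes_eq L f hf]
  rw [key _ _ _ f hf]

theorem Dual_zero (f : gl F 0 → ℂ) (hf : Inv f) : Dual 0 f = f := by
  funext z
  have : Subsingleton (Composition 0) :=
    Fintype.card_le_one_iff_subsingleton.1 (by rw [composition_card]; simp)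
  rw [Dual_eq 0 f hf, Fintype.sum_subsingleton _ (Composition.ones 0)]
  simp [RR]

/-- Prepending a block to a composition. -/
def consComp (n : ℕ) (s : Σ k : Fin n, Composition (n - 1 - k.1)) : Composition n where
  blocks := (s.1.1 + 1) :: s.2.blocks
  blocks_pos := by
    intro i hi
    rcases List.mem_cons.1 hi with rfl | hi
    · omega
    · exact s.2.blocks_pos hi
  blocks_sum := by
    rw [List.sum_cons, s.2.blocks_sum]
    have := s.1.2
    omega

theorem consComp_bij (n : ℕ) (hn : 1 ≤ n) : Function.Bijective (consComp n) := by
  constructor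
  · rintro ⟨k, c⟩ ⟨k', c'⟩ h
    have h1 := congrArg Composition.blocks h
    simp only [consComp, List.cons.injEq] at h1
    obtain rfl : k = k' := Fin.ext (by omega)
    obtain rfl : c = c' := Composition.ext h1.2
    rfl
  · intro c
    obtain ⟨L, hpos, hsum⟩ := c
    cases L with
    | nil => simp at hsum; omega
    | cons b L =>
      have hb : 0 < b := hpos (by simp)
      rw [List.sum_cons] at hsum
      refine ⟨⟨⟨b - 1, by omega⟩, ⟨L, fun hi => hpos (by simp [hi]), by simp only; omega⟩⟩, ?_⟩
      apply Composition.ext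
      simp only [consComp, List.cons.injEq, and_true]
      omega

theorem Dual_rec {n : ℕ} (h1 : 1 ≤ n) (f : gl F n → ℂ) (hf : Inv f) (z : gl F n) :
    Dual n f z = ∑ k ∈ Finset.range n, (-1) ^ k *
      Ind (Fin (k + 1)) (Fin (n - 1 - k)) (Fin n)
        (fun x y => Dual (n - 1 - k) (Res (Fin (k + 1)) (Fin (n - 1 - k)) f x) y) z := by
  rw [Dual_eq n f hf, ← (consComp_bij n h1).sum_comp, Fintype.sum_sigma, Finset.sum_range]
  apply Finset.sum_congr rfl
  intro k _
  have e : ∀ (x : gl F (k.1 + 1)) (y : gl F (n - 1 - k.1)),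
      Dual (n - 1 - k.1) (Res (Fin (k.1 + 1)) (Fin (n - 1 - k.1)) f x) y =
      ∑ c : Composition (n - 1 - k.1), (-1 : ℂ) ^ (n - 1 - k.1 - c.length) *
        RR c.blocks (n - 1 - k.1) (Res (Fin (k.1 + 1)) (Fin (n - 1 - k.1)) f x) y :=
    fun x y => Dual_eq _ _ (Res_Inv_right _ _) y
  rw [Ind_congr e, Ind_sum, Finset.mul_sum]
  apply Finset.sum_congr rfl
  intro c _
  rw [Ind_mul, ← mul_assoc, ← pow_add]
  have hl := c.length_le
  have hk := k.2
  have hs : n - (consComp n ⟨k, c⟩).length = k.1 + (n - 1 - k.1 - c.length) := by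
    have : (consComp n ⟨k, c⟩).length = c.length + 1 := rfl
    rw [this]
    omega
  rw [hs]
  congr 1
  have key : ∀ (L : List ℕ) (S : ℕ), L.sum = S →
      RR ((k.1 + 1) :: L) n f z = Ind (Fin (k.1 + 1)) (Fin S) (Fin n) (fun x y =>
        RR L S (Res (Fin (k.1 + 1)) (Fin S) f x) y) z := by
    intro L S e
    subst e
    rfl
  exact key _ _ c.blocks_sum

end Bridge

/-- finite analogue of the characterisation of the duality operations. -/
theorem dual_characterisation_finite (F : Type) [Field F] [Fintype F] [DecidableEq F]
    (m : ℕ) (hm : 1 ≤ m)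
    (D : ∀ n : ℕ, (gl F n → ℂ) → (gl F n → ℂ))
    (hmap : ∀ (n : ℕ), n ≤ m → ∀ f : gl F n → ℂ, Invariant n f → Invariant n (D n f))
    (hlin : ∀ (n : ℕ), n ≤ m → ∀ (a : ℂ) (f g : gl F n → ℂ),
      Invariant n f → Invariant n g → D n (a • f + g) = a • D n f + D n g)
    (hzero : ∀ f : gl F 0 → ℂ, D 0 f = f)
    (hind : ∀ (n₁ n₂ : ℕ), 1 ≤ n₁ → 1 ≤ n₂ → n₁ + n₂ ≤ m →
      ∀ (f₁ : gl F n₁ → ℂ) (f₂ : gl F n₂ → ℂ), Invariant n₁ f₁ → Invariant n₂ f₂ →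
      D (n₁ + n₂) (HCind n₁ n₂ fun p => f₁ p.1 * f₂ p.2) =
        HCind n₁ n₂ fun p => D n₁ f₁ p.1 * D n₂ f₂ p.2)
    (hcusp : ∀ (n : ℕ), 1 ≤ n → n ≤ m → ∀ f : gl F n → ℂ, Invariant n f → PreCuspidal n f →
      D n f = ((-1 : ℂ)) ^ (n - 1) • f) :
    ∀ (n : ℕ), n ≤ m → ∀ f : gl F n → ℂ, Invariant n f → D n f = Dual n f := by
  have hD : DD m D := by
    constructor
    · intro n hn f hf
      exact (Invariant_iff _).1 (hmap n hn f ((Invariant_iff _).2 hf))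
    · intro n hn f g hf hg z
      have h := congrFun (hlin n hn 1 f g ((Invariant_iff _).2 hf) ((Invariant_iff _).2 hg)) z
      rw [one_smul, one_smul] at h
      exact h
    · intro n hn c f hf z
      have h0 := hlin n hn 1 (fun _ => 0) (fun _ => 0) (fun _ _ => rfl) (fun _ _ => rfl)
      have hz : D n (fun _ => 0) = 0 := by
        have e : ((1 : ℂ) • (fun _ => 0) + (fun _ => 0) : gl F n → ℂ) = fun _ => 0 := by
          funext z
          simp
        rw [e, one_smul] at h0
        exact left_eq_add.1 h0
      have h := congrFun (hlin n hn c f (fun _ => 0) ((Invariant_iff _).2 hf) (fun _ _ => rfl)) z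
      have e : (c • f + (fun _ => 0) : gl F n → ℂ) = fun x => c * f x := by
        funext z
        simp
      rw [e, hz, add_zero] at h
      exact h
    · intro a b n e hn g h hg hh
      have hmul : ∀ (k : ℕ), k ≤ m → ∀ (c : ℂ) (f : gl F k → ℂ), Inv f → ∀ z,
          D k (fun x => c * f x) z = c * D k f z := by
        intro n hn c f hf z
        have h0 := hlin n hn 1 (fun _ => 0) (fun _ => 0) (fun _ _ => rfl) (fun _ _ => rfl)
        have hz : D n (fun _ => 0) = 0 := by
          have e : ((1 : ℂ) • (fun _ => 0) + (fun _ => 0) : gl F n → ℂ) = fun _ => 0 := by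
            funext z
            simp
          rw [e, one_smul] at h0
          exact left_eq_add.1 h0
        have h := congrFun (hlin n hn c f (fun _ => 0) ((Invariant_iff _).2 hf) (fun _ _ => rfl)) z
        have e : (c • f + (fun _ => 0) : gl F n → ℂ) = fun x => c * f x := by
          funext z
          simp
        rw [e, hz, add_zero] at h
        exact h
      have hmapI : ∀ (k : ℕ), k ≤ m → ∀ f : gl F k → ℂ, Inv f → Inv (D k f) := by
        intro n hn f hf
        exact (Invariant_iff _).1 (hmap n hn f ((Invariant_iff _).2 hf))
      rcases Nat.eq_zero_or_pos a with ha | ha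
      · subst ha
        obtain rfl : b = n := by omega
        have e1 : ∀ (g' : gl F 0 → ℂ) (h' : gl F b → ℂ), Inv h' →
            mm (Fin b) g' h' = fun z => g' 0 * h' z := by
          intro g' h' hh'
          funext z
          unfold mm
          rw [Ind_left_empty]
          exact TT_self (Inv_mul _ hh') z
        rw [e1 g h hh, e1 _ _ (hmapI b hn h hh), hzero]
        funext z
        exact hmul b hn _ h hh z
      · rcases Nat.eq_zero_or_pos b with hb | hb
        · subst hb
          obtain rfl : a = n := by omega
          have e1 : ∀ (g' : gl F a → ℂ) (h' : gl F 0 → ℂ), Inv g' →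
              mm (Fin a) g' h' = fun z => h' 0 * g' z := by
            intro g' h' hh'
            funext z
            unfold mm
            rw [Ind_right_empty, TT_congr (fun x => mul_comm _ _)]
            exact TT_self (Inv_mul _ hh') z
          rw [e1 g h hg, e1 _ _ (hmapI a hn g hg), hzero]
          funext z
          exact hmul a hn _ g hg z
        · subst e
          have e1 : ∀ (g' : gl F a → ℂ) (h' : gl F b → ℂ), Inv g' → Inv h' →
              (HCind a b fun p => g' p.1 * h' p.2) = mm (Fin (a + b)) g' h' := by
            intro g' h' hg' hh'
            refine HCind_eq a b (fun x y => g' x * h' y) (fun x => Inv_mul _ hh') ?_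
            intro y G x
            have := hg' G x
            simp only [this]
          have := hind a b ha hb hn g h ((Invariant_iff _).2 hg) ((Invariant_iff _).2 hh)
          rw [e1 g h hg hh, e1 _ _ (hmapI a (by omega) g hg) (hmapI b (by omega) h hh)] at this
          exact this
    · intro n h1 hn f hf hp z
      have := congrFun (hcusp n h1 hn f ((Invariant_iff _).2 hf) (PreCuspidal_of_Prim f hf hp)) z
      exact this
  intro n
  induction n using Nat.strong_induction_on with
  | _ n ih =>
  intro hn f hf'
  have hf := (Invariant_iff _).1 hf'
  rcases Nat.eq_zero_or_pos n with h0 | h1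
  · subst h0
    rw [hzero, Dual_zero f hf]
  · funext z
    rw [D_rec hD h1 hn f hf z, Dual_rec h1 f hf z]
    apply Finset.sum_congr rfl
    intro k hk
    congr 1
    apply Ind_congr
    intro x y
    rw [ih (n - 1 - k) (by omega) (by omega) _ ((Invariant_iff _).2 (Res_Inv_right f x))]

end HCPaper
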